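/- arXiv:math-ph/0509007 — 4 statements merged into one kernel-verified Lean document; each statement's English description precedes it below -/
import Mathlib

section
/- (Dani's correspondence.) Let d ≥ 2 and let M ∈ SL(d,ℝ) be of the form M = [[1_{d−1}, α],[0, 1]]·[[A, 0],[ᵀβ, γ]] with A a (d−1)×(d−1) real matrix, α, β ∈ ℝ^{d−1} and γ > 0. Then the following are equivalent: (1) there exists a compact set K ⊆ SL(d,ℝ) such that for every t ≥ 0 there is P ∈ SL(d,ℤ) with P·M·E^t ∈ K (i.e. the orbit {Γ M E^t : t ≥ 0} is bounded in SL(d,ℤ)\SL(d,ℝ)); (2) α is of bounded type, i.e. there exists C > 0 such that |kα + m|^{d−1}·|k| > C for all m ∈ ℤ^{d−1} and k ∈ ℤ ∖ {0}, where |·| is the maximum norm on ℝ^{d−1}. -/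
open scoped BigOperators
open Matrix

noncomputable section

/-- `E^t = diag(e^{-t},…,e^{-t}, e^{(d-1)t})` on `ℝ^d` with `d = m+1`. -/
def Emat (m : ℕ) (t : ℝ) : Matrix (Fin (m+1)) (Fin (m+1)) ℝ :=
  Matrix.diagonal (Fin.snoc (fun _ : Fin m => Real.exp (-t)) (Real.exp ((m : ℝ) * t)))

/-- The block matrix `[[1, α],[0, 1]]` (sizes `(m)+(1)`). -/
def blockU {m : ℕ} (α : Fin m → ℝ) : Matrix (Fin (m+1)) (Fin (m+1)) ℝ :=
  Matrix.of (Fin.snoc (fun i : Fin m =>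
      Fin.snoc (fun j : Fin m => if i = j then (1:ℝ) else 0) (α i))
    (Fin.snoc (fun _ : Fin m => (0:ℝ)) 1))

/-- The block matrix `[[A, 0],[ᵀβ, γ]]` (sizes `(m)+(1)`). -/
def blockL {m : ℕ} (A : Matrix (Fin m) (Fin m) ℝ) (β : Fin m → ℝ) (γ : ℝ) :
    Matrix (Fin (m+1)) (Fin (m+1)) ℝ :=
  Matrix.of (Fin.snoc (fun i : Fin m => Fin.snoc (fun j : Fin m => A i j) 0)
    (Fin.snoc β γ))

/-- `α ∈ ℝ^{d-1}` is Diophantine with exponent `ε` and constant `C`: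
`|m|^{(d-1)(1+ε)} |m·α + k| > C` for all `m ∈ ℤ^{d-1} ∖ {0}`, `k ∈ ℤ` (max norm). -/
def DioVec {m : ℕ} (α : Fin m → ℝ) (ε C : ℝ) : Prop :=
  ∀ q : Fin m → ℤ, q ≠ 0 → ∀ k : ℤ,
    C < ‖((fun i => (q i : ℝ)) : Fin m → ℝ)‖ ^ ((m : ℝ) * (1 + ε)) *
        |(∑ i, (q i : ℝ) * α i) + (k : ℝ)|

/-- The data of a Siegel-set decomposition `M = N ⬝ diagonal a ⬝ K` in `S_d(κ)`:
`N` unipotent upper triangular with entries bounded by `κ`, `a` positive with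
product `1` and `a j ≥ (√3/2) a (j+1)`, and `K ∈ SO(d)`. -/
def IsSiegelTriple {m : ℕ} (κ : ℝ) (N K : Matrix (Fin (m+1)) (Fin (m+1)) ℝ)
    (a : Fin (m+1) → ℝ) : Prop :=
  (∀ i, N i i = 1) ∧ (∀ i j : Fin (m+1), j < i → N i j = 0) ∧
  (∀ i j : Fin (m+1), i < j → |N i j| ≤ κ) ∧
  (∀ i, 0 < a i) ∧ (∏ i, a i = 1) ∧
  (∀ i : Fin m, Real.sqrt 3 / 2 * a i.succ ≤ a i.castSucc) ∧
  K * K.transpose = 1 ∧ K.det = 1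

/-- Membership in the Siegel set `S_d(κ)`. -/
def InSiegelSet {m : ℕ} (κ : ℝ) (M : Matrix (Fin (m+1)) (Fin (m+1)) ℝ) : Prop :=
  ∃ N K a, IsSiegelTriple κ N K a ∧ M = N * Matrix.diagonal a * K

/-- Euclidean norm on `ℝ^n`. -/
def eucNorm {n : ℕ} (v : Fin n → ℝ) : ℝ := Real.sqrt (∑ i, v i ^ 2)

/-- Operator norm of a matrix induced by the Euclidean norm. -/
def eucOpNorm {n : ℕ} (M : Matrix (Fin n) (Fin n) ℝ) : ℝ :=
  sSup {c | ∃ v : Fin n → ℝ, eucNorm v ≤ 1 ∧ c = eucNorm (M.mulVec v)}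

/-- `δ(M) = inf_{k ∈ ℤ^d ∖ {0}} |ᵀk M|` (max norm). -/
def deltaFn {m : ℕ} (M : Matrix (Fin (m+1)) (Fin (m+1)) ℝ) : ℝ :=
  ⨅ k : {k : Fin (m+1) → ℤ // k ≠ 0}, ‖Matrix.vecMul (fun i => (k.1 i : ℝ)) M‖

/-- `θ = (d-1)ε/(d + (d-1)ε)` with `d = m+1`. -/
def thetaOf (m : ℕ) (ε : ℝ) : ℝ := (m : ℝ) * ε / ((m + 1 : ℝ) + (m : ℝ) * ε)

end

/-- The value at `v` of the quadratic form with matrix `S`. -/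
def quadVal {n : ℕ} (S : Matrix (Fin n) (Fin n) ℝ) (v : Fin n → ℝ) : ℝ := v ⬝ᵥ S *ᵥ v

/-- The `j`-th column of an integer matrix, as a real vector. -/
def realCol {n : ℕ} (Q : Matrix (Fin n) (Fin n) ℤ) (j : Fin n) : Fin n → ℝ :=
  fun i => (Q i j : ℝ)

/-- The matrix with diagonal blocks `a`, `B`, upper right block `u`, and lower left block `0`. -/
def upperBlock {R : Type*} [CommRing R] {n : ℕ} (a : R) (u : Fin n → R)
    (B : Matrix (Fin n) (Fin n) R) : Matrix (Fin (n + 1)) (Fin (n + 1)) R :=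
  Matrix.of (Fin.cons (Fin.cons a u) (fun i => Fin.cons 0 (B i)))

/-- The Schur complement of the upper left entry. -/
noncomputable def schurCompl {n : ℕ} (S : Matrix (Fin (n + 1)) (Fin (n + 1)) ℝ) : Matrix (Fin n) (Fin n) ℝ :=
  Matrix.of fun i j => S i.succ j.succ - S 0 i.succ * S 0 j.succ / S 0 0

lemma det_upperBlock {R : Type*} [CommRing R] {n : ℕ} (a : R) (u : Fin n → R)
    (B : Matrix (Fin n) (Fin n) R) : (upperBlock a u B).det = a * B.det := by
  rw [Matrix.det_succ_column_zero, Fin.sum_univ_succ]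
  have : (upperBlock a u B).submatrix Fin.succ Fin.succ = B := by
    ext i j; simp [upperBlock]
  simp [this]
  simp [upperBlock]

lemma det_eq_mul_det_schurCompl {n : ℕ} (S : Matrix (Fin (n + 1)) (Fin (n + 1)) ℝ)
    (hS : S.IsSymm) (h0 : S 0 0 ≠ 0) : S.det = S 0 0 * (schurCompl S).det := by
  have key : (upperBlock 1 (fun j => -(S 0 j.succ / S 0 0)) 1)ᵀ * S =
      upperBlock (S 0 0) (fun j => S 0 j.succ) (schurCompl S) := by
    ext i j
    refine Fin.cases ?_ (fun i => ?_) i <;> refine Fin.cases ?_ (fun j => ?_) j <;>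
      simp [Matrix.mul_apply, Fin.sum_univ_succ, upperBlock, schurCompl, Matrix.one_apply]
    · rw [← hS.apply 0 i.succ]; field_simp; ring
    · field_simp; ring
  have h := congrArg Matrix.det key
  rw [Matrix.det_mul, Matrix.det_transpose, det_upperBlock, det_upperBlock] at h
  simpa using h

lemma quadVal_cons {n : ℕ} (S : Matrix (Fin (n + 1)) (Fin (n + 1)) ℝ)
    (hS : S.IsSymm) (h0 : S 0 0 ≠ 0) (x : ℝ) (y : Fin n → ℝ) :
    quadVal S (Fin.cons x y) =
      S 0 0 * (x + (∑ i, S 0 i.succ * y i) / S 0 0) ^ 2 + quadVal (schurCompl S) y := by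
  have e : quadVal (schurCompl S) y = (∑ i, y i * ∑ j, S i.succ j.succ * y j) -
      (∑ i, S 0 i.succ * y i) ^ 2 / S 0 0 := by
    simp only [quadVal, dotProduct, mulVec, schurCompl, Matrix.of_apply]
    rw [sq, Finset.sum_mul_sum, Finset.sum_div, ← Finset.sum_sub_distrib]
    refine Finset.sum_congr rfl fun i _ => ?_
    rw [Finset.mul_sum, Finset.mul_sum, Finset.sum_div, ← Finset.sum_sub_distrib]
    refine Finset.sum_congr rfl fun j _ => ?_
    ring
  have e2 : quadVal S (Fin.cons x y) = S 0 0 * x ^ 2 + 2 * x * (∑ i, S 0 i.succ * y i) +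
      ∑ i, y i * ∑ j, S i.succ j.succ * y j := by
    simp only [quadVal, dotProduct, mulVec, Fin.sum_univ_succ, Fin.cons_zero, Fin.cons_succ,
      mul_add, Finset.sum_add_distrib]
    have : ∑ i : Fin n, y i * (S i.succ 0 * x) = x * ∑ i, S 0 i.succ * y i := by
      rw [Finset.mul_sum]
      refine Finset.sum_congr rfl fun i _ => ?_
      rw [← hS.apply 0 i.succ]; ring
    rw [this]; ring
  rw [e, e2]; field_simp; ring

lemma realCol_upperBlock_zero {n : ℕ} (c : Fin n → ℤ) (B : Matrix (Fin n) (Fin n) ℤ) :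
    realCol (upperBlock 1 c B) 0 = Fin.cons 1 0 := by
  ext i; refine Fin.cases ?_ (fun i => ?_) i <;> simp [realCol, upperBlock]

lemma realCol_upperBlock_succ {n : ℕ} (c : Fin n → ℤ) (B : Matrix (Fin n) (Fin n) ℤ)
    (j : Fin n) : realCol (upperBlock 1 c B) j.succ = Fin.cons (c j : ℝ) (realCol B j) := by
  ext i; refine Fin.cases ?_ (fun i => ?_) i <;> simp [realCol, upperBlock]

lemma quadVal_congruence {n : ℕ} (S Q : Matrix (Fin n) (Fin n) ℝ) (v : Fin n → ℝ) :
    quadVal (Qᵀ * S * Q) v = quadVal S (Q *ᵥ v) := by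
  simp only [quadVal, ← Matrix.mulVec_mulVec, Matrix.dotProduct_mulVec, Matrix.vecMul_transpose]

lemma realCol_mul {n : ℕ} (P Q : Matrix (Fin n) (Fin n) ℤ) (j : Fin n) :
    realCol (P * Q) j = P.map (Int.cast : ℤ → ℝ) *ᵥ realCol Q j := by
  ext i; simp [realCol, Matrix.mul_apply, mulVec, dotProduct]

lemma det_map_intCast {n : ℕ} (P : Matrix (Fin n) (Fin n) ℤ) :
    (P.map (Int.cast : ℤ → ℝ)).det = (P.det : ℝ) :=
  (Int.cast_det P).symm

lemma sq_intCast_det {n : ℕ} {P : Matrix (Fin n) (Fin n) ℤ} (hP : IsUnit P.det) :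
    (P.det : ℝ) * P.det = 1 := by
  exact_mod_cast Int.isUnit_mul_self hP

/-- Hermite reduction of forms whose values on primitive vectors are bounded below: if a nonzero
vector close to the minimum is the first basis vector, bounds pass to the Schur complement. -/
lemma exists_bounded_of_firstEntry_le {n : ℕ} {δ D R : ℝ} (hδ : 0 < δ)
    (hR : ∀ T : Matrix (Fin n) (Fin n) ℝ, T.IsSymm → T.det ≤ |D| / δ →
      (∀ Q : Matrix (Fin n) (Fin n) ℤ, IsUnit Q.det → ∀ j, δ / 2 ≤ quadVal T (realCol Q j)) →
      ∃ Q : Matrix (Fin n) (Fin n) ℤ, IsUnit Q.det ∧ ∀ j, quadVal T (realCol Q j) ≤ R)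
    (S : Matrix (Fin (n + 1)) (Fin (n + 1)) ℝ) (hS : S.IsSymm) (hD : S.det ≤ D)
    (hmin : ∀ Q : Matrix (Fin (n + 1)) (Fin (n + 1)) ℤ, IsUnit Q.det → ∀ j,
      3 / 4 * S 0 0 ≤ quadVal S (realCol Q j)) (h0 : δ ≤ S 0 0) :
    ∃ Q : Matrix (Fin (n + 1)) (Fin (n + 1)) ℤ, IsUnit Q.det ∧
      ∀ j, quadVal S (realCol Q j) ≤ |D| + 3 * |R| := by
  have hs : 0 < S 0 0 := hδ.trans_le h0
  have shift : ∀ Q' : Matrix (Fin n) (Fin n) ℤ, IsUnit Q'.det →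
      ∃ Q : Matrix (Fin (n + 1)) (Fin (n + 1)) ℤ, IsUnit Q.det ∧
        quadVal S (realCol Q 0) = S 0 0 ∧ ∀ j : Fin n, quadVal S (realCol Q j.succ) ≤
          S 0 0 / 4 + quadVal (schurCompl S) (realCol Q' j) := by
    intro Q' hQ'
    set b : Fin n → ℝ := fun j => (∑ i, S 0 i.succ * realCol Q' j i) / S 0 0 with hb
    refine ⟨upperBlock 1 (fun j => -round (b j)) Q', by simpa [det_upperBlock] using hQ', ?_, ?_⟩
    · rw [realCol_upperBlock_zero, quadVal_cons S hS hs.ne']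
      simp [quadVal]
    · intro j
      rw [realCol_upperBlock_succ, quadVal_cons S hS hs.ne']
      have h1 := abs_sub_round (b j)
      have h2 : (((-round (b j) : ℤ) : ℝ) + b j) ^ 2 ≤ 1 / 4 := by
        rw [← sq_abs]
        push_cast
        rw [neg_add_eq_sub]
        nlinarith [abs_nonneg (b j - round (b j))]
      have := mul_le_mul_of_nonneg_left h2 hs.le
      simp only [hb] at this
      linarith
  have hdet := det_eq_mul_det_schurCompl S hS hs.ne'
  have hT : ∀ Q' : Matrix (Fin n) (Fin n) ℤ, IsUnit Q'.det → ∀ j,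
      S 0 0 / 2 ≤ quadVal (schurCompl S) (realCol Q' j) := by
    intro Q' hQ' j
    obtain ⟨Q, hQ, -, h⟩ := shift Q' hQ'
    linarith [h j, hmin Q hQ j.succ]
  obtain ⟨Q', hQ', hb⟩ := hR (schurCompl S) (by
      ext i j
      simp only [schurCompl, Matrix.transpose_apply, Matrix.of_apply, hS.apply i.succ j.succ]
      ring)
    (by
      rw [le_div_iff₀ hδ]
      rcases le_or_gt (schurCompl S).det 0 with h | h
      · exact (mul_nonpos_of_nonpos_of_nonneg h hδ.le).trans (abs_nonneg D)
      · calc (schurCompl S).det * δ ≤ S 0 0 * (schurCompl S).det := by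
              rw [mul_comm]; exact mul_le_mul_of_nonneg_right h0 h.le
          _ ≤ |D| := by rw [← hdet]; exact hD.trans (le_abs_self D))
    (fun Q' hQ' j => by linarith [hT Q' hQ' j])
  obtain ⟨Q, hQ, hq0, hq⟩ := shift Q' hQ'
  have hs_le : S 0 0 ≤ |D| + 2 * |R| := by
    rcases n with _ | n
    · rw [Matrix.det_isEmpty (A := schurCompl S), mul_one] at hdet
      linarith [le_abs_self D, abs_nonneg R]
    · linarith [hT Q' hQ' 0, hb 0, le_abs_self R, abs_nonneg D]
  refine ⟨Q, hQ, fun j => ?_⟩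
  refine Fin.cases ?_ (fun j => ?_) j
  · linarith [abs_nonneg R]
  · linarith [hq j, hb j, le_abs_self R, abs_nonneg D, abs_nonneg R]

lemma exists_nearly_minimal {n : ℕ} {δ : ℝ} (hδ : 0 < δ)
    (S : Matrix (Fin (n + 1)) (Fin (n + 1)) ℝ)
    (h : ∀ Q : Matrix (Fin (n + 1)) (Fin (n + 1)) ℤ, IsUnit Q.det → ∀ j,
      δ ≤ quadVal S (realCol Q j)) :
    ∃ P : Matrix (Fin (n + 1)) (Fin (n + 1)) ℤ, IsUnit P.det ∧
      ∀ Q : Matrix (Fin (n + 1)) (Fin (n + 1)) ℤ, IsUnit Q.det → ∀ j,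
        3 / 4 * quadVal S (realCol P 0) ≤ quadVal S (realCol Q j) := by
  set V : Set ℝ := {x | ∃ Q : Matrix (Fin (n + 1)) (Fin (n + 1)) ℤ, IsUnit Q.det ∧
    ∃ j, x = quadVal S (realCol Q j)} with hV
  have hne : V.Nonempty := ⟨_, 1, by simp, 0, rfl⟩
  have hbd : δ ∈ lowerBounds V := by
    rintro _ ⟨Q, hQ, j, rfl⟩; exact h Q hQ j
  have hinf : δ ≤ sInf V := le_csInf hne hbd
  obtain ⟨_, ⟨Q, hQ, j, rfl⟩, hlt⟩ :=
    exists_lt_of_csInf_lt hne (show sInf V < 4 / 3 * sInf V by linarith)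
  refine ⟨Q.submatrix id (Equiv.swap 0 j), ?_, fun Q' hQ' j' => ?_⟩
  · rw [Matrix.det_permute']
    exact IsUnit.mul (Units.isUnit _) hQ
  · have e : realCol (Q.submatrix id (Equiv.swap 0 j)) 0 = realCol Q j := by
      ext i; simp [realCol]
    have := csInf_le ⟨δ, hbd⟩ (show quadVal S (realCol Q' j') ∈ V from ⟨Q', hQ', j', rfl⟩)
    rw [e]; linarith

/-- Hermite reduction: a form bounded below on primitive integer vectors takes values on some
basis of `ℤ^n` bounded in terms of that lower bound and its determinant. -/
lemma exists_reduced_basis (n : ℕ) : ∀ δ : ℝ, 0 < δ → ∀ D : ℝ, ∃ R : ℝ,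
    ∀ S : Matrix (Fin n) (Fin n) ℝ, S.IsSymm → S.det ≤ D →
      (∀ Q : Matrix (Fin n) (Fin n) ℤ, IsUnit Q.det → ∀ j, δ ≤ quadVal S (realCol Q j)) →
      ∃ Q : Matrix (Fin n) (Fin n) ℤ, IsUnit Q.det ∧ ∀ j, quadVal S (realCol Q j) ≤ R := by
  induction n with
  | zero => exact fun δ _ D => ⟨0, fun S _ _ _ => ⟨1, by simp, fun j => j.elim0⟩⟩
  | succ n ih =>
    intro δ hδ D
    obtain ⟨R, hR⟩ := ih (δ / 2) (half_pos hδ) (|D| / δ)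
    refine ⟨|D| + 3 * |R|, fun S hS hD h => ?_⟩
    obtain ⟨P, hP, hmin⟩ := exists_nearly_minimal hδ S h
    set PR := P.map (Int.cast : ℤ → ℝ) with hPR
    have hval : ∀ (Q : Matrix (Fin (n + 1)) (Fin (n + 1)) ℤ) (j),
        quadVal (PRᵀ * S * PR) (realCol Q j) = quadVal S (realCol (P * Q) j) := by
      intro Q j
      rw [quadVal_congruence, realCol_mul]
    have h00 : (PRᵀ * S * PR) 0 0 = quadVal S (realCol P 0) := by
      have e : (PRᵀ * S * PR) 0 0 = quadVal (PRᵀ * S * PR) (realCol 1 0) := by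
        have : realCol (1 : Matrix (Fin (n + 1)) (Fin (n + 1)) ℤ) 0 = Pi.single 0 1 := by
          ext i; simp [realCol, Matrix.one_apply, Pi.single_apply]
        rw [this, quadVal]; simp
      rw [e, hval, mul_one]
    obtain ⟨Q, hQ, hb⟩ := exists_bounded_of_firstEntry_le (D := D) hδ hR (PRᵀ * S * PR)
      (by
        rw [Matrix.IsSymm, Matrix.transpose_mul, Matrix.transpose_mul, Matrix.transpose_transpose,
          hS.eq, Matrix.mul_assoc])
      (by
        rw [Matrix.det_mul, Matrix.det_mul, Matrix.det_transpose, hPR, det_map_intCast]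
        calc (P.det : ℝ) * S.det * P.det = (P.det * P.det : ℝ) * S.det := by ring
          _ ≤ D := by rw [sq_intCast_det hP, one_mul]; exact hD)
      (fun Q hQ j => by
        rw [hval, h00]
        exact hmin _ (by rw [Matrix.det_mul]; exact hP.mul hQ) j)
      (by rw [h00]; exact h P hP 0)
    refine ⟨P * Q, by rw [Matrix.det_mul]; exact hP.mul hQ, fun j => ?_⟩
    rw [← hval]; exact hb j

lemma norm_mulVec_le_of_entry_le {n : ℕ} {r : ℝ} (N : Matrix (Fin n) (Fin n) ℝ)
    (hN : ∀ i j, |N i j| ≤ r) (hr : 0 ≤ r) (y : Fin n → ℝ) : ‖N *ᵥ y‖ ≤ n * r * ‖y‖ := by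
  refine (pi_norm_le_iff_of_nonneg (by positivity)).2 fun i => ?_
  calc ‖(N *ᵥ y) i‖ ≤ ∑ j, ‖N i j * y j‖ := by
        rw [mulVec, dotProduct]; exact norm_sum_le _ _
    _ ≤ ∑ _j : Fin n, r * ‖y‖ := by
        refine Finset.sum_le_sum fun j _ => ?_
        rw [norm_mul]
        exact mul_le_mul (hN i j) (norm_le_pi_norm y j) (norm_nonneg _) hr
    _ = n * r * ‖y‖ := by simp [mul_assoc]

lemma exists_norm_mulVec_le {n : ℕ} (N : Matrix (Fin n) (Fin n) ℝ) :
    ∃ B : ℝ, 1 ≤ B ∧ ∀ y : Fin n → ℝ, ‖N *ᵥ y‖ ≤ B * ‖y‖ := by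
  refine ⟨max 1 ‖N.mulVecLin.toContinuousLinearMap‖, le_max_left _ _, fun y => ?_⟩
  refine (N.mulVecLin.toContinuousLinearMap.le_opNorm y).trans ?_
  exact mul_le_mul_of_nonneg_right (le_max_right _ _) (norm_nonneg _)

lemma exists_abs_dotProduct_le {n : ℕ} (β : Fin n → ℝ) :
    ∃ B : ℝ, 1 ≤ B ∧ ∀ y : Fin n → ℝ, |β ⬝ᵥ y| ≤ B * ‖y‖ := by
  refine ⟨1 + ∑ i, |β i|, by simp [Finset.sum_nonneg], fun y => ?_⟩
  calc |β ⬝ᵥ y| ≤ ∑ i, |β i * y i| := Finset.abs_sum_le_sum_abs _ _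
    _ ≤ ∑ i, |β i| * ‖y‖ := by
        refine Finset.sum_le_sum fun i _ => ?_
        rw [abs_mul]
        exact mul_le_mul_of_nonneg_left (norm_le_pi_norm y i) (abs_nonneg _)
    _ ≤ (1 + ∑ i, |β i|) * ‖y‖ := by
        rw [← Finset.sum_mul]
        exact mul_le_mul_of_nonneg_right (by linarith) (norm_nonneg _)

lemma one_le_norm_intCast {n : ℕ} {v : Fin n → ℤ} (hv : v ≠ 0) :
    1 ≤ ‖(fun i => (v i : ℝ))‖ := by
  obtain ⟨i, hi⟩ := Function.ne_iff.1 hv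
  refine le_trans ?_ (norm_le_pi_norm _ i)
  rw [Real.norm_eq_abs, ← Int.cast_abs]
  exact_mod_cast Int.one_le_abs hi

lemma col_ne_zero_of_isUnit_det {n : ℕ} {Q : Matrix (Fin n) (Fin n) ℤ} (hQ : IsUnit Q.det)
    (j : Fin n) : (fun i => Q i j) ≠ 0 := by
  intro h
  rw [Matrix.det_eq_zero_of_column_eq_zero j fun i => congrFun h i] at hQ
  simp at hQ

/-- Change of sign of a column turns a unimodular integer matrix into one of determinant one. -/
lemma exists_det_eq_one {n : ℕ} (S : Matrix (Fin (n + 1)) (Fin (n + 1)) ℝ)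
    (Q : Matrix (Fin (n + 1)) (Fin (n + 1)) ℤ) (hQ : IsUnit Q.det) :
    ∃ P : Matrix (Fin (n + 1)) (Fin (n + 1)) ℤ, P.det = 1 ∧
      ∀ j, quadVal S (realCol P j) = quadVal S (realCol Q j) := by
  rcases Int.isUnit_iff.1 hQ with h | h
  · exact ⟨Q, h, fun _ => rfl⟩
  · refine ⟨Q.updateCol 0 ((-1 : ℤ) • fun i => Q i 0), ?_, fun j => ?_⟩
    · have e : Q.updateCol 0 (fun i => Q i 0) = Q := Matrix.updateCol_eq_self Q 0
      rw [Matrix.det_updateCol_smul, e, h]; norm_num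
    · by_cases hj : j = 0
      · subst hj
        have : realCol (Q.updateCol 0 ((-1 : ℤ) • fun i => Q i 0)) 0 = -realCol Q 0 := by
          ext i; simp [realCol]
        rw [this]; simp [quadVal, Matrix.mulVec_neg]
      · congr 1; ext i; simp [realCol, Matrix.updateCol_ne hj]

lemma quadVal_transpose_mul_self {n : ℕ} (g : Matrix (Fin n) (Fin n) ℝ) (v : Fin n → ℝ) :
    quadVal (gᵀ * g) v = ∑ i, (g *ᵥ v) i ^ 2 := by
  rw [quadVal, ← Matrix.mulVec_mulVec, Matrix.dotProduct_mulVec, Matrix.vecMul_transpose]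
  simp [dotProduct, sq]

/-- Mahler's compactness criterion, for the lattices `G⁻¹ ℤ^n` with `G` in a set of matrices of
determinant one. -/
lemma mahler_criterion {n : ℕ} {ι : Type*} (s : Set ι)
    (G : ι → Matrix (Fin (n + 1)) (Fin (n + 1)) ℝ) (hG : ∀ t ∈ s, (G t).det = 1) :
    (∃ K : Set (Matrix (Fin (n + 1)) (Fin (n + 1)) ℝ), IsCompact K ∧ (∀ N ∈ K, N.det = 1) ∧
      ∀ t ∈ s, ∃ P : Matrix (Fin (n + 1)) (Fin (n + 1)) ℤ, P.det = 1 ∧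
        P.map (Int.cast : ℤ → ℝ) * G t ∈ K) ↔
    ∃ δ > (0 : ℝ), ∀ t ∈ s, ∀ v : Fin (n + 1) → ℤ, v ≠ 0 → ∀ y : Fin (n + 1) → ℝ,
      G t *ᵥ y = (fun i => (v i : ℝ)) → δ ≤ ‖y‖ := by
  constructor
  · rintro ⟨K, hK, -, hP⟩
    obtain ⟨r, hr⟩ := hK.exists_bound_of_continuousOn
      (f := fun N : Matrix (Fin (n + 1)) (Fin (n + 1)) ℝ => (fun i j => N i j : _ → _ → ℝ))
      (by fun_prop)
    have hpos : (0 : ℝ) < ((n + 1 : ℕ) : ℝ) * (|r| + 1) := by positivity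
    refine ⟨(((n + 1 : ℕ) : ℝ) * (|r| + 1))⁻¹, by positivity, fun t ht v hv y hy => ?_⟩
    obtain ⟨P, hdet, hmem⟩ := hP t ht
    have hb : ∀ i j, |(P.map (Int.cast : ℤ → ℝ) * G t) i j| ≤ |r| + 1 := by
      intro i j
      have h1 := (norm_le_pi_norm _ j).trans ((norm_le_pi_norm _ i).trans (hr _ hmem))
      exact h1.trans (by linarith [le_abs_self r])
    have h2 := norm_mulVec_le_of_entry_le _ hb (by positivity) y
    have h3 : P *ᵥ v ≠ 0 := by
      intro h
      refine hv (Matrix.eq_zero_of_mulVec_eq_zero (M := P) (by simp [hdet]) h)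
    have h4 : (P.map (Int.cast : ℤ → ℝ) * G t) *ᵥ y = fun i => ((P *ᵥ v) i : ℝ) := by
      rw [← Matrix.mulVec_mulVec, hy]
      ext i; simp [mulVec, dotProduct]
    rw [h4] at h2
    rw [inv_le_iff_one_le_mul₀' hpos]
    exact (one_le_norm_intCast h3).trans h2
  · rintro ⟨δ, hδ, h⟩
    obtain ⟨R, hR⟩ := exists_reduced_basis (n + 1) (δ ^ 2) (by positivity) 1
    set H : Set (Matrix (Fin (n + 1)) (Fin (n + 1)) ℝ) :=
      (Set.univ.pi fun _ => Set.univ.pi fun _ => Set.Icc (-√R) √R) ∩ {N | N.det = 1} with hH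
    have hHc : IsCompact H := by
      refine IsCompact.inter_right ?_ ?_
      · exact isCompact_univ_pi fun _ => isCompact_univ_pi fun _ => isCompact_Icc
      · exact isClosed_eq (continuous_id.matrix_det) continuous_const
    refine ⟨Matrix.adjugate '' H, hHc.image (continuous_id.matrix_adjugate), ?_, fun t ht => ?_⟩
    · rintro _ ⟨N, hN, rfl⟩
      rw [Matrix.det_adjugate, hN.2, one_pow]
    · have hGu : IsUnit (G t).det := by rw [hG t ht]; exact isUnit_one
      set g := (G t)⁻¹ with hg
      have hgdet : g.det = 1 := by
        rw [hg, Matrix.det_nonsing_inv, hG t ht, Ring.inverse_one]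
      obtain ⟨Q₀, hQ₀, hb₀⟩ := hR (gᵀ * g) (by simp [Matrix.IsSymm])
        (by simp [hgdet]) (fun Q hQ j => by
          have h1 := h t ht _ (col_ne_zero_of_isUnit_det hQ j) (g *ᵥ realCol Q j) (by
            rw [Matrix.mulVec_mulVec, hg, Matrix.mul_nonsing_inv _ hGu, Matrix.one_mulVec]
            rfl)
          rw [quadVal_transpose_mul_self]
          by_contra! hlt
          refine absurd h1 (not_le.2 ?_)
          refine (pi_norm_lt_iff hδ).2 fun i => ?_
          rw [Real.norm_eq_abs]
          refine abs_lt_of_sq_lt_sq ?_ hδ.le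
          exact (Finset.single_le_sum (f := fun i => (g *ᵥ realCol Q j) i ^ 2)
            (fun i _ => sq_nonneg _) (Finset.mem_univ i)).trans_lt hlt)
      obtain ⟨Q, hQ, hQv⟩ := exists_det_eq_one (gᵀ * g) Q₀ hQ₀
      refine ⟨Q.adjugate, by rw [Matrix.det_adjugate, hQ, one_pow],
        g * Q.map (Int.cast : ℤ → ℝ), ⟨?_, ?_⟩, ?_⟩
      · intro i _ j _
        rw [Set.mem_Icc, ← abs_le]
        refine Real.abs_le_sqrt ?_
        have h1 := hb₀ j
        rw [← hQv, quadVal_transpose_mul_self] at h1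
        exact (Finset.single_le_sum (f := fun i => (g *ᵥ realCol Q j) i ^ 2)
          (fun i _ => sq_nonneg _) (Finset.mem_univ i)).trans h1
      · simp [det_map_intCast, hQ, hgdet]
      · have hQu : (Q.map (Int.cast : ℤ → ℝ)).adjugate = Q.adjugate.map (Int.cast : ℤ → ℝ) :=
          ((Int.castRingHom ℝ).map_adjugate Q).symm
        have hga : g.adjugate = G t := by
          have h1 := Matrix.inv_def g
          rw [hgdet, Ring.inverse_one, one_smul, hg, Matrix.nonsing_inv_nonsing_inv _ hGu] at h1
          exact h1.symm
        rw [Matrix.adjugate_mul_distrib, hQu, hga]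

lemma det_blockU {m : ℕ} (α : Fin m → ℝ) : (blockU α).det = 1 := by
  rw [Matrix.det_of_isUpperTriangular]
  · refine Finset.prod_eq_one fun i _ => ?_
    refine Fin.lastCases ?_ (fun i => ?_) i <;> simp [blockU]
  · intro i j hij
    refine Fin.lastCases (fun h => ?_) (fun i => ?_) i hij
    · induction j using Fin.lastCases with
      | last => exact absurd h (lt_irrefl _)
      | cast j => simp [blockU]
    · intro h
      induction j using Fin.lastCases with
      | last => exact absurd h (not_lt.2 (Fin.le_last _))
      | cast j =>
        have : i ≠ j := by rintro rfl; exact absurd h (lt_irrefl _)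
        simp [blockU, this]

lemma det_blockL {m : ℕ} (A : Matrix (Fin m) (Fin m) ℝ) (β : Fin m → ℝ) (γ : ℝ) :
    (blockL A β γ).det = A.det * γ := by
  rw [Matrix.det_succ_column _ (Fin.last m), Fin.sum_univ_castSucc]
  have : (blockL A β γ).submatrix Fin.castSucc Fin.castSucc = A := by
    ext i j; simp [blockL]
  simp [this, ← two_mul, pow_mul]
  simp [blockL, mul_comm]

lemma det_Emat (m : ℕ) (t : ℝ) : (Emat m t).det = 1 := by
  rw [Emat, Matrix.det_diagonal, Fin.prod_univ_castSucc]
  simp [← Real.exp_nat_mul, ← Real.exp_add]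

lemma blockU_mulVec_snoc {m : ℕ} (α x : Fin m → ℝ) (k : ℝ) :
    blockU α *ᵥ (Fin.snoc x k : Fin (m + 1) → ℝ) = Fin.snoc (x + k • α) k := by
  ext i
  refine Fin.lastCases ?_ (fun i => ?_) i <;>
    simp [blockU, mulVec, dotProduct, Fin.sum_univ_castSucc, mul_comm]

lemma blockL_mulVec_snoc {m : ℕ} (A : Matrix (Fin m) (Fin m) ℝ) (β z : Fin m → ℝ) (γ w : ℝ) :
    blockL A β γ *ᵥ (Fin.snoc z w : Fin (m + 1) → ℝ) = Fin.snoc (A *ᵥ z) (β ⬝ᵥ z + γ * w) := by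
  ext i
  refine Fin.lastCases ?_ (fun i => ?_) i <;>
    simp [blockL, mulVec, dotProduct, Fin.sum_univ_castSucc]

lemma Emat_mulVec_snoc {m : ℕ} (t : ℝ) (z : Fin m → ℝ) (w : ℝ) :
    Emat m t *ᵥ (Fin.snoc z w : Fin (m + 1) → ℝ) =
      Fin.snoc (Real.exp (-t) • z) (Real.exp (m * t) * w) := by
  ext i
  refine Fin.lastCases ?_ (fun i => ?_) i <;> simp [Emat, Matrix.mulVec_diagonal]

lemma orbit_mulVec_snoc {m : ℕ} (α β : Fin m → ℝ) (A : Matrix (Fin m) (Fin m) ℝ) (γ t : ℝ)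
    (z : Fin m → ℝ) (w : ℝ) :
    (blockU α * blockL A β γ * Emat m t) *ᵥ (Fin.snoc z w : Fin (m + 1) → ℝ) =
      Fin.snoc (A *ᵥ (Real.exp (-t) • z) +
        (β ⬝ᵥ (Real.exp (-t) • z) + γ * (Real.exp (m * t) * w)) • α)
        (β ⬝ᵥ (Real.exp (-t) • z) + γ * (Real.exp (m * t) * w)) := by
  rw [← Matrix.mulVec_mulVec, ← Matrix.mulVec_mulVec, Emat_mulVec_snoc, blockL_mulVec_snoc,
    blockU_mulVec_snoc]

lemma norm_snoc_lt_iff {m : ℕ} {δ : ℝ} (hδ : 0 < δ) (z : Fin m → ℝ) (w : ℝ) :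
    ‖(Fin.snoc z w : Fin (m + 1) → ℝ)‖ < δ ↔ ‖z‖ < δ ∧ |w| < δ := by
  rw [pi_norm_lt_iff hδ, pi_norm_lt_iff hδ, Fin.forall_fin_succ']
  simp

lemma bounded_type_of_lower_bound {m : ℕ} (hm : 1 ≤ m) (α β : Fin m → ℝ)
    (A : Matrix (Fin m) (Fin m) ℝ) {γ δ : ℝ} (hγ : 0 < γ) (hA : IsUnit A.det) (hδ : 0 < δ)
    (h : ∀ t : ℝ, 0 ≤ t → ∀ v : Fin (m + 1) → ℤ, v ≠ 0 → ∀ y : Fin (m + 1) → ℝ,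
      (blockU α * blockL A β γ * Emat m t) *ᵥ y = (fun i => (v i : ℝ)) → δ ≤ ‖y‖) :
    ∃ C > (0 : ℝ), ∀ k : ℤ, k ≠ 0 → ∀ q : Fin m → ℤ,
      C < ‖((fun i => (k : ℝ) * α i + (q i : ℝ)) : Fin m → ℝ)‖ ^ m * |(k : ℝ)| := by
  obtain ⟨B₁, hB₁, hA'⟩ := exists_norm_mulVec_le A⁻¹
  obtain ⟨B₂, hB₂, hβ⟩ := exists_abs_dotProduct_le β
  set B := (1 + B₂ * B₁) / γ + 1 + δ with hB
  have hB0 : 0 < B := by positivity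
  have hδB : δ ≤ B := by
    have : 0 < (1 + B₂ * B₁) / γ := by positivity
    linarith
  have hmR : (0 : ℝ) < m := by exact_mod_cast hm
  refine ⟨min (1 / 2) ((δ / B₁) ^ m * (δ / (4 * B)) / 2), by positivity, fun k hk q => ?_⟩
  set x : Fin m → ℝ := fun i => (k : ℝ) * α i + q i with hx
  have hk1 : (1 : ℝ) ≤ |(k : ℝ)| := by
    rw [← Int.cast_abs]; exact_mod_cast Int.one_le_abs hk
  rcases le_or_gt 1 ‖x‖ with h1 | h1
  · calc min (1 / 2) _ ≤ (1 / 2 : ℝ) := min_le_left _ _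
      _ < 1 * 1 := by norm_num
      _ ≤ ‖x‖ ^ m * |(k : ℝ)| := mul_le_mul (one_le_pow₀ h1) hk1 zero_le_one (by positivity)
  · set t := Real.log (4 * B * |(k : ℝ)| / δ) / m with ht
    have harg : 1 ≤ 4 * B * |(k : ℝ)| / δ := by
      rw [le_div_iff₀ hδ]; nlinarith
    have ht0 : 0 ≤ t := div_nonneg (Real.log_nonneg harg) hmR.le
    have hexp : Real.exp (m * t) = 4 * B * |(k : ℝ)| / δ := by
      rw [ht, mul_div_cancel₀ _ hmR.ne', Real.exp_log (by linarith)]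
    set z := A⁻¹ *ᵥ x with hz
    set w := (-(k : ℝ) - β ⬝ᵥ z) / γ with hw
    have hy := h t ht0 (Fin.snoc q (-k)) (fun h0 => hk (by
        have := congrFun h0 (Fin.last m); simpa using this))
      (Fin.snoc (Real.exp t • z) (Real.exp (-(m * t)) * w)) (by
        rw [orbit_mulVec_snoc, smul_smul, ← Real.exp_add, ← mul_assoc (Real.exp _),
          ← Real.exp_add]
        have e1 : β ⬝ᵥ z + γ * w = -k := by rw [hw]; field_simp; ring
        have e2 : A *ᵥ z = x := by
          rw [hz, Matrix.mulVec_mulVec, Matrix.mul_nonsing_inv _ hA, Matrix.one_mulVec]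
        simp only [neg_add_cancel, add_neg_cancel, Real.exp_zero, one_smul, one_mul, e1, e2]
        ext i
        refine Fin.lastCases ?_ (fun i => ?_) i <;> simp [hx])
    have hw1 : |w| ≤ 2 * B * |(k : ℝ)| := by
      have hβz : |β ⬝ᵥ z| ≤ B₂ * B₁ * |(k : ℝ)| := by
        calc |β ⬝ᵥ z| ≤ B₂ * (B₁ * ‖x‖) :=
              (hβ z).trans (mul_le_mul_of_nonneg_left (hA' x) (by linarith))
          _ ≤ B₂ * (B₁ * |(k : ℝ)|) := by gcongr; linarith
          _ = B₂ * B₁ * |(k : ℝ)| := by ring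
      calc |w| = |-(k : ℝ) - β ⬝ᵥ z| / γ := by rw [hw, abs_div, abs_of_pos hγ]
        _ ≤ (|(k : ℝ)| + B₂ * B₁ * |(k : ℝ)|) / γ := by
            gcongr
            calc |-(k : ℝ) - β ⬝ᵥ z| ≤ |-(k : ℝ)| + |β ⬝ᵥ z| := abs_sub _ _
              _ ≤ _ := by rw [abs_neg]; gcongr
        _ = (1 + B₂ * B₁) / γ * |(k : ℝ)| := by ring
        _ ≤ 2 * B * |(k : ℝ)| := by gcongr; linarith
    have hw2 : |Real.exp (-(m * t)) * w| < δ := by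
      rw [abs_mul, abs_of_pos (Real.exp_pos _), Real.exp_neg, hexp, inv_mul_lt_iff₀ (by linarith)]
      calc |w| ≤ 2 * B * |(k : ℝ)| := hw1
        _ < 4 * B * |(k : ℝ)| := by nlinarith
        _ = _ := by field_simp
    have hz1 : δ ≤ Real.exp t * (B₁ * ‖x‖) := by
      by_contra! hlt
      refine absurd hy (not_le.2 ((norm_snoc_lt_iff hδ _ _).2 ⟨?_, hw2⟩))
      rw [norm_smul, Real.norm_eq_abs, abs_of_pos (Real.exp_pos _)]
      exact (mul_le_mul_of_nonneg_left (hA' x) (Real.exp_pos _).le).trans_lt hlt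
    have hpow : (δ / B₁) ^ m ≤ 4 * B * |(k : ℝ)| / δ * ‖x‖ ^ m := by
      rw [← hexp, Real.exp_nat_mul, ← mul_pow]
      refine pow_le_pow_left₀ (by positivity) ?_ m
      rw [div_le_iff₀ (by linarith)]
      linarith
    calc min (1 / 2) _ ≤ (δ / B₁) ^ m * (δ / (4 * B)) / 2 := min_le_right _ _
      _ < (δ / B₁) ^ m * (δ / (4 * B)) := half_lt_self (by positivity)
      _ ≤ 4 * B * |(k : ℝ)| / δ * ‖x‖ ^ m * (δ / (4 * B)) := by gcongr
      _ = ‖x‖ ^ m * |(k : ℝ)| := by field_simp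

lemma lower_bound_of_bounded_type {m : ℕ} (α β : Fin m → ℝ)
    (A : Matrix (Fin m) (Fin m) ℝ) {γ C : ℝ} (hC : 0 < C)
    (h : ∀ k : ℤ, k ≠ 0 → ∀ q : Fin m → ℤ,
      C < ‖((fun i => (k : ℝ) * α i + (q i : ℝ)) : Fin m → ℝ)‖ ^ m * |(k : ℝ)|) :
    ∃ δ > (0 : ℝ), ∀ t : ℝ, 0 ≤ t → ∀ v : Fin (m + 1) → ℤ, v ≠ 0 → ∀ y : Fin (m + 1) → ℝ,
      (blockU α * blockL A β γ * Emat m t) *ᵥ y = (fun i => (v i : ℝ)) → δ ≤ ‖y‖ := by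
  obtain ⟨B₁, hB₁, hA'⟩ := exists_norm_mulVec_le A
  obtain ⟨B₂, hB₂, hβ⟩ := exists_abs_dotProduct_le β
  set B := B₂ + |γ| with hB
  have hB0 : 0 < B := by positivity
  set δ := min 1 (min (1 / B₁) (C / (B₁ ^ m * B))) with hδ
  have hδ0 : 0 < δ := by positivity
  refine ⟨δ, hδ0, fun t ht v hv y hy => ?_⟩
  by_contra! hlt
  set z := Fin.init y with hz
  set w := y (Fin.last m) with hw
  set q := Fin.init v with hq
  set k := v (Fin.last m) with hk
  have hv' : v = Fin.snoc q k := (Fin.snoc_init_self v).symm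
  have hy' : y = Fin.snoc z w := (Fin.snoc_init_self y).symm
  rw [hy', norm_snoc_lt_iff hδ0] at hlt
  rw [hy', orbit_mulVec_snoc] at hy
  have hkeq := congrFun hy (Fin.last m)
  simp only [Fin.snoc_last, ← hk] at hkeq
  have hqeq : A *ᵥ (Real.exp (-t) • z) = fun i => (q i : ℝ) - k * α i := by
    ext i
    have := congrFun hy i.castSucc
    rw [hkeq] at this
    simp only [Fin.snoc_castSucc, Pi.add_apply, Pi.smul_apply, smul_eq_mul] at this
    change _ = (q i : ℝ) at this
    linarith
  have hz1 : ‖Real.exp (-t) • z‖ ≤ Real.exp (-t) * δ := by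
    rw [norm_smul, Real.norm_eq_abs, abs_of_pos (Real.exp_pos _)]
    gcongr; exact hlt.1.le
  have hx : ‖(fun i => (q i : ℝ) - k * α i)‖ ≤ B₁ * (Real.exp (-t) * ‖z‖) := by
    rw [← hqeq]
    refine (hA' _).trans (le_of_eq ?_)
    rw [norm_smul, Real.norm_eq_abs, abs_of_pos (Real.exp_pos _)]
  have hexp : Real.exp (-t) ≤ 1 := Real.exp_le_one_iff.2 (by linarith)
  by_cases hk0 : k = 0
  · have hq0 : q ≠ 0 := by
      rintro h0
      refine hv ?_
      rw [hv', h0, hk0]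
      ext i; refine Fin.lastCases ?_ (fun i => ?_) i <;> simp
    have h1 := one_le_norm_intCast hq0
    simp only [hk0, Int.cast_zero, zero_mul, sub_zero] at hx
    have h2 : B₁ * (Real.exp (-t) * ‖z‖) ≤ B₁ * ‖z‖ := by
      gcongr; exact mul_le_of_le_one_left (norm_nonneg _) hexp
    have h3 : ‖z‖ < 1 / B₁ := hlt.1.trans_le ((min_le_right _ _).trans (min_le_left _ _))
    rw [lt_div_iff₀ (by linarith)] at h3
    linarith
  · have h1 := h (-k) (neg_ne_zero.2 hk0) q
    have e : (fun i => ((-k : ℤ) : ℝ) * α i + (q i : ℝ)) = fun i => (q i : ℝ) - k * α i := by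
      ext i; push_cast; ring
    rw [e, Int.cast_neg, abs_neg] at h1
    have hexp1 : Real.exp (-t) ≤ Real.exp (m * t) :=
      Real.exp_le_exp.2 (by have : 0 ≤ (m : ℝ) * t := by positivity
                            linarith)
    have hk1 : |(k : ℝ)| ≤ B * (Real.exp (m * t) * δ) := by
      rw [← hkeq]
      calc |β ⬝ᵥ (Real.exp (-t) • z) + γ * (Real.exp (m * t) * w)|
          ≤ |β ⬝ᵥ (Real.exp (-t) • z)| + |γ * (Real.exp (m * t) * w)| := abs_add_le _ _
        _ ≤ B₂ * (Real.exp (m * t) * δ) + |γ| * (Real.exp (m * t) * δ) := by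
            refine add_le_add ((hβ _).trans ?_) ?_
            · exact mul_le_mul_of_nonneg_left (hz1.trans (by gcongr)) (by linarith)
            · rw [abs_mul, abs_mul, abs_of_pos (Real.exp_pos _)]
              gcongr; exact hlt.2.le
        _ = B * (Real.exp (m * t) * δ) := by rw [hB]; ring
    have hx1 : ‖(fun i => (q i : ℝ) - k * α i)‖ ≤ B₁ * Real.exp (-t) := by
      refine hx.trans ?_
      gcongr
      exact mul_le_of_le_one_right (Real.exp_pos _).le (hlt.1.le.trans (min_le_left _ _))
    have hee : Real.exp (-t) ^ m * Real.exp (m * t) = 1 := by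
      rw [← Real.exp_nat_mul, ← Real.exp_add]; simp
    have hδC : δ ≤ C / (B₁ ^ m * B) := (min_le_right _ _).trans (min_le_right _ _)
    rw [le_div_iff₀ (by positivity)] at hδC
    refine absurd h1 (not_lt.2 ?_)
    calc ‖(fun i => (q i : ℝ) - k * α i)‖ ^ m * |(k : ℝ)|
        ≤ (B₁ * Real.exp (-t)) ^ m * (B * (Real.exp (m * t) * δ)) := by gcongr
      _ = (Real.exp (-t) ^ m * Real.exp (m * t)) * (δ * (B₁ ^ m * B)) := by ring
      _ ≤ C := by rw [hee, one_mul]; exact hδC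

/-- (Dani's correspondence.) For `M` of the parametrized form,
the orbit `{Γ M E^t : t ≥ 0}` is bounded in `SL(d,ℤ)\SL(d,ℝ)` (i.e. there is a
compact set `K ⊆ SL(d,ℝ)` such that for each `t ≥ 0` some `P ∈ SL(d,ℤ)` brings
`P M E^t` into `K`) if and only if `α` is of bounded type. -/
theorem dani_correspondence (m : ℕ) (hm : 1 ≤ m)
    (α β : Fin m → ℝ) (A : Matrix (Fin m) (Fin m) ℝ) (γ : ℝ) (hγ : 0 < γ)
    (M : Matrix (Fin (m+1)) (Fin (m+1)) ℝ)
    (hM : M = blockU α * blockL A β γ) (hdet : M.det = 1) :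
    (∃ K : Set (Matrix (Fin (m+1)) (Fin (m+1)) ℝ), IsCompact K ∧
      (∀ N ∈ K, N.det = 1) ∧
      ∀ t : ℝ, 0 ≤ t → ∃ P : Matrix (Fin (m+1)) (Fin (m+1)) ℤ, P.det = 1 ∧
        (P.map (Int.cast : ℤ → ℝ)) * (M * Emat m t) ∈ K) ↔
    (∃ C > (0:ℝ), ∀ k : ℤ, k ≠ 0 → ∀ q : Fin m → ℤ,
      C < ‖((fun i => (k : ℝ) * α i + (q i : ℝ)) : Fin m → ℝ)‖ ^ m * |(k : ℝ)|) := by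
  have hA : IsUnit A.det := by
    rw [hM, Matrix.det_mul, det_blockU, det_blockL, one_mul] at hdet
    exact IsUnit.of_mul_eq_one _ hdet
  refine (mahler_criterion (Set.Ici (0 : ℝ)) (fun t => M * Emat m t)
    (fun t _ => by rw [Matrix.det_mul, hdet, det_Emat, one_mul])).trans ?_
  subst hM
  constructor
  · rintro ⟨δ, hδ, h⟩
    exact bounded_type_of_lower_bound hm α β A hγ hA hδ h
  · rintro ⟨C, hC, h⟩
    exact lower_bound_of_bounded_type α β A hC h
end

section
/- Let d ≥ 1 and κ > 0. There exist constants 0 < C₁ ≤ C₂ (depending only on d and κ) such that for every matrix M = n·a·k in the Siegel set S_d(κ) with 0 < a_d ≤ 1 one has C₁·a_d ≤ δ(M) ≤ C₂·a_d, where a_d is the last diagonal entry of a. -/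
open scoped BigOperators
open Matrix

theorem abs_entry_le_one_of_mul_transpose_eq_one {n : Type*} [Fintype n] [DecidableEq n]
    {K : Matrix n n ℝ} (hK : K * K.transpose = 1) (i j : n) : |K i j| ≤ 1 := by
  have h : ∑ l, K i l * K i l = 1 := by
    simpa [Matrix.mul_apply] using congrFun (congrFun hK i) i
  have hj : K i j * K i j ≤ ∑ l, K i l * K i l :=
    Finset.single_le_sum (f := fun l => K i l * K i l)
      (fun l _ => mul_self_nonneg _) (Finset.mem_univ j)
  exact abs_le_one_iff_mul_self_le_one.2 (hj.trans h.le)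

/-- Undoing an orthogonal matrix on the right costs at most a factor of the dimension
in the max norm. -/
theorem abs_apply_le_card_mul_norm_vecMul {n : Type*} [Fintype n] [DecidableEq n]
    {K : Matrix n n ℝ} (hK : K * K.transpose = 1) (w : n → ℝ) (i : n) :
    |w i| ≤ Fintype.card n * ‖w ᵥ* K‖ := by
  have hw : w i = ∑ j, (w ᵥ* K) j * K i j := by
    have h : (w ᵥ* K) ᵥ* K.transpose = w := by
      rw [Matrix.vecMul_vecMul, hK, Matrix.vecMul_one]
    conv_lhs => rw [← h]
    rfl
  calc |w i| ≤ ∑ j, |(w ᵥ* K) j * K i j| := by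
        rw [hw]
        exact Finset.abs_sum_le_sum_abs _ _
    _ ≤ ∑ _j : n, ‖w ᵥ* K‖ := by
        refine Finset.sum_le_sum fun j _ => ?_
        rw [abs_mul]
        exact (mul_le_of_le_one_right (abs_nonneg _)
          (abs_entry_le_one_of_mul_transpose_eq_one hK i j)).trans (norm_le_pi_norm (w ᵥ* K) j)
    _ = Fintype.card n * ‖w ᵥ* K‖ := by simp

theorem pow_mul_last_le {m : ℕ} {c : ℝ} (hc : 0 ≤ c) {a : Fin (m+1) → ℝ}
    (h : ∀ i : Fin m, c * a i.succ ≤ a i.castSucc) (i : Fin (m+1)) :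
    c ^ (m - (i : ℕ)) * a (Fin.last m) ≤ a i := by
  induction i using Fin.reverseInduction with
  | last => simp
  | cast i ih =>
    refine le_trans ?_ (h i)
    have hi : m - ((i.castSucc : Fin (m+1)) : ℕ) = (m - ((i.succ : Fin (m+1)) : ℕ)) + 1 := by
      simp only [Fin.val_castSucc, Fin.val_succ]
      omega
    rw [hi, pow_succ', mul_assoc]
    exact mul_le_mul_of_nonneg_left ih hc

theorem exists_first_ne_zero {m : ℕ} {k : Fin (m+1) → ℤ} (hk : k ≠ 0) :
    ∃ i, k i ≠ 0 ∧ ∀ j < i, k j = 0 := by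
  obtain ⟨i, hi, hmin⟩ := WellFounded.has_min (wellFounded_lt (α := Fin (m+1)))
    {i | k i ≠ 0} (Function.ne_iff.1 hk)
  exact ⟨i, hi, fun j hj => by_contra fun h => hmin j h hj⟩

theorem vecMul_unipotent_apply_first {m : ℕ} {N : Matrix (Fin (m+1)) (Fin (m+1)) ℝ}
    (hN1 : ∀ i, N i i = 1) (hN0 : ∀ i j : Fin (m+1), j < i → N i j = 0)
    {v : Fin (m+1) → ℝ} {i : Fin (m+1)} (hv : ∀ j < i, v j = 0) :
    (v ᵥ* N) i = v i := by
  simp only [Matrix.vecMul, dotProduct]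
  rw [Finset.sum_eq_single i, hN1, mul_one]
  · intro j _ hj
    rcases lt_or_gt_of_ne hj with h | h
    · rw [hv j h, zero_mul]
    · rw [hN0 j i h, mul_zero]
  · simp

theorem deltaFn_le {m : ℕ} (M : Matrix (Fin (m+1)) (Fin (m+1)) ℝ) {k : Fin (m+1) → ℤ}
    (hk : k ≠ 0) : deltaFn M ≤ ‖Matrix.vecMul (fun i => (k i : ℝ)) M‖ :=
  ciInf_le (f := fun k : {k : Fin (m+1) → ℤ // k ≠ 0} =>
      ‖Matrix.vecMul (fun i => (k.1 i : ℝ)) M‖)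
    ⟨0, by rintro _ ⟨k, rfl⟩; exact norm_nonneg _⟩ ⟨k, hk⟩

theorem deltaFn_le_last {m : ℕ} {κ : ℝ} {N K : Matrix (Fin (m+1)) (Fin (m+1)) ℝ}
    {a : Fin (m+1) → ℝ} (h : IsSiegelTriple κ N K a) :
    deltaFn (N * Matrix.diagonal a * K) ≤ a (Fin.last m) := by
  obtain ⟨hN1, hN0, -, ha, -, -, hK, -⟩ := h
  have hk : (Pi.single (Fin.last m) 1 : Fin (m+1) → ℤ) ≠ 0 := by simp
  refine (deltaFn_le _ hk).trans ?_
  have hcast : (fun i => ((Pi.single (Fin.last m) 1 : Fin (m+1) → ℤ) i : ℝ)) =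
      Pi.single (Fin.last m) 1 := by
    ext i
    simp [Pi.single_apply]
  have hrow : (Pi.single (Fin.last m) 1 : Fin (m+1) → ℝ) ᵥ* N = Pi.single (Fin.last m) 1 := by
    ext j
    rw [Matrix.single_one_vecMul]
    rcases eq_or_ne j (Fin.last m) with rfl | hj
    · simp [Matrix.row, hN1]
    · simp [Matrix.row, hj, hN0 _ _ (Fin.lt_last_iff_ne_last.2 hj)]
  rw [hcast, ← Matrix.vecMul_vecMul, ← Matrix.vecMul_vecMul, hrow]
  refine (pi_norm_le_iff_of_nonneg (ha _).le).2 fun j => ?_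
  have hval : (((Pi.single (Fin.last m) 1 : Fin (m+1) → ℝ) ᵥ* Matrix.diagonal a) ᵥ* K) j =
      a (Fin.last m) * K (Fin.last m) j := by
    simp [Matrix.vecMul, dotProduct, Matrix.diagonal_apply, Pi.single_apply]
  rw [hval, Real.norm_eq_abs, abs_mul, abs_of_pos (ha _)]
  exact mul_le_of_le_one_right (ha _).le (abs_entry_le_one_of_mul_transpose_eq_one hK _ _)

theorem le_deltaFn {m : ℕ} {κ : ℝ} {N K : Matrix (Fin (m+1)) (Fin (m+1)) ℝ}
    {a : Fin (m+1) → ℝ} (h : IsSiegelTriple κ N K a) :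
    (Real.sqrt 3 / 2) ^ m / (m + 1) * a (Fin.last m) ≤
      deltaFn (N * Matrix.diagonal a * K) := by
  obtain ⟨hN1, hN0, -, ha, -, hstep, hK, -⟩ := h
  have : Nonempty {k : Fin (m+1) → ℤ // k ≠ 0} := ⟨⟨1, one_ne_zero⟩⟩
  refine le_ciInf fun ⟨k, hk⟩ => ?_
  obtain ⟨i, hi, hlt⟩ := exists_first_ne_zero hk
  set v : Fin (m+1) → ℝ := fun i => (k i : ℝ)
  have hsqrt : Real.sqrt 3 / 2 ≤ 1 := by
    have : Real.sqrt 3 ≤ 2 := Real.sqrt_le_iff.2 (by norm_num)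
    linarith
  have hvi : 1 ≤ |(k i : ℝ)| := by exact_mod_cast Int.one_le_abs hi
  have hw : ((v ᵥ* N) ᵥ* Matrix.diagonal a) i = v i * a i := by
    rw [Matrix.vecMul_diagonal, vecMul_unipotent_apply_first hN1 hN0]
    intro j hj
    simp [v, hlt j hj]
  have hbound := abs_apply_le_card_mul_norm_vecMul hK ((v ᵥ* N) ᵥ* Matrix.diagonal a) i
  rw [hw, abs_mul, abs_of_pos (ha i), Fintype.card_fin, Matrix.vecMul_vecMul,
    Matrix.vecMul_vecMul, ← Matrix.mul_assoc] at hbound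
  rw [div_mul_eq_mul_div, div_le_iff₀' (by positivity)]
  calc (Real.sqrt 3 / 2) ^ m * a (Fin.last m)
      ≤ (Real.sqrt 3 / 2) ^ (m - (i : ℕ)) * a (Fin.last m) :=
        mul_le_mul_of_nonneg_right
          (pow_le_pow_of_le_one (by positivity) hsqrt (Nat.sub_le _ _)) (ha _).le
    _ ≤ a i := pow_mul_last_le (by positivity) hstep i
    _ ≤ |v i| * a i := le_mul_of_one_le_left (ha i).le hvi
    _ ≤ _ := by exact_mod_cast hbound

/-- (Lemma on Siegel sets.) There are constants `0 < C₁ ≤ C₂`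
(depending only on `d` and `κ`) such that every `M = n·a·k` in the Siegel set
`S_d(κ)` with `0 < a_d ≤ 1` satisfies `C₁ a_d ≤ δ(M) ≤ C₂ a_d`. -/
theorem siegel_delta_estimate (m : ℕ) (κ : ℝ) (hκ : 0 < κ) :
    ∃ C₁ C₂ : ℝ, 0 < C₁ ∧ C₁ ≤ C₂ ∧
      ∀ (N K : Matrix (Fin (m+1)) (Fin (m+1)) ℝ) (a : Fin (m+1) → ℝ),
        IsSiegelTriple κ N K a → a (Fin.last m) ≤ 1 →
        C₁ * a (Fin.last m) ≤ deltaFn (N * Matrix.diagonal a * K) ∧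
        deltaFn (N * Matrix.diagonal a * K) ≤ C₂ * a (Fin.last m) := by
  refine ⟨(Real.sqrt 3 / 2) ^ m / (m + 1), 1, by positivity, ?_, fun N K a h _ =>
    ⟨le_deltaFn h, (deltaFn_le_last h).trans_eq (one_mul _).symm⟩⟩
  have hsqrt : Real.sqrt 3 ≤ 2 := Real.sqrt_le_iff.2 (by norm_num)
  rw [div_le_one (by positivity)]
  have hpow : (Real.sqrt 3 / 2) ^ m ≤ 1 := pow_le_one₀ (by positivity) (by linarith)
  have hm : (0 : ℝ) ≤ m := m.cast_nonneg
  linarith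
end

section
/- Let d ≥ 2, let M ∈ SL(d,ℝ) be of the form M = [[1_{d−1}, α],[0, 1]]·[[A, 0],[ᵀβ, γ]] with A a (d−1)×(d−1) real matrix, α, β ∈ ℝ^{d−1} and γ > 0, and suppose α is Diophantine with exponent ε and constant C. Then there exists a constant C′ > 0 such that for all t ≥ 0, δ(M E^t) > C′·e^{−θt}, where θ = (d−1)ε/(d + (d−1)ε). -/
open scoped BigOperators
open Matrix

theorem vecMul_blockU_mul_blockL_last {m : ℕ} (α β : Fin m → ℝ) (A : Matrix (Fin m) (Fin m) ℝ)
    (γ : ℝ) (v : Fin (m + 1) → ℝ) :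
    Matrix.vecMul v (blockU α * blockL A β γ) (Fin.last m) =
      ((∑ i, v i.castSucc * α i) + v (Fin.last m)) * γ := by
  rw [← Matrix.vecMul_vecMul]
  simp [Matrix.vecMul, dotProduct, Fin.sum_univ_castSucc, blockU, blockL]

theorem vecMul_mul_Emat_castSucc {m : ℕ} (M : Matrix (Fin (m + 1)) (Fin (m + 1)) ℝ) (t : ℝ)
    (v : Fin (m + 1) → ℝ) (i : Fin m) :
    Matrix.vecMul v (M * Emat m t) i.castSucc =
      Matrix.vecMul v M i.castSucc * Real.exp (-t) := by
  rw [← Matrix.vecMul_vecMul, Emat, Matrix.vecMul_diagonal, Fin.snoc_castSucc]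

theorem vecMul_mul_Emat_last {m : ℕ} (M : Matrix (Fin (m + 1)) (Fin (m + 1)) ℝ) (t : ℝ)
    (v : Fin (m + 1) → ℝ) :
    Matrix.vecMul v (M * Emat m t) (Fin.last m) =
      Matrix.vecMul v M (Fin.last m) * Real.exp (m * t) := by
  rw [← Matrix.vecMul_vecMul, Emat, Matrix.vecMul_diagonal, Fin.snoc_last]

theorem abs_vecMul_last_le {m : ℕ} (M : Matrix (Fin (m + 1)) (Fin (m + 1)) ℝ) (t : ℝ)
    (v : Fin (m + 1) → ℝ) :
    |Matrix.vecMul v M (Fin.last m)| ≤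
      ‖Matrix.vecMul v (M * Emat m t)‖ * Real.exp (-(m * t)) := by
  have h := norm_le_pi_norm (Matrix.vecMul v (M * Emat m t)) (Fin.last m)
  rw [vecMul_mul_Emat_last, Real.norm_eq_abs, abs_mul, Real.abs_exp] at h
  rwa [Real.exp_neg, ← div_eq_mul_inv, le_div_iff₀ (Real.exp_pos _)]

theorem norm_vecMul_le_norm_vecMul_mul_Emat {m : ℕ} (M : Matrix (Fin (m + 1)) (Fin (m + 1)) ℝ)
    {t : ℝ} (ht : 0 ≤ t) (v : Fin (m + 1) → ℝ) :
    ‖Matrix.vecMul v M‖ ≤ ‖Matrix.vecMul v (M * Emat m t)‖ * Real.exp t := by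
  refine (pi_norm_le_iff_of_nonneg (by positivity)).2 fun j => ?_
  induction j using Fin.lastCases with
  | last =>
    refine (abs_vecMul_last_le M t v).trans ?_
    gcongr
    nlinarith [mul_nonneg (Nat.cast_nonneg (α := ℝ) m) ht]
  | cast i =>
    have h := norm_le_pi_norm (Matrix.vecMul v (M * Emat m t)) i.castSucc
    rw [vecMul_mul_Emat_castSucc, norm_mul, Real.norm_of_nonneg (Real.exp_pos _).le,
      Real.exp_neg, ← div_eq_mul_inv, div_le_iff₀ (Real.exp_pos _)] at h
    exact h

theorem exists_norm_le_mul_norm_vecMul {n : ℕ} (M : Matrix (Fin n) (Fin n) ℝ)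
    (hM : IsUnit M.det) : ∃ K > (0 : ℝ), ∀ v : Fin n → ℝ, ‖v‖ ≤ K * ‖Matrix.vecMul v M‖ := by
  let L := LinearMap.toContinuousLinearMap (Matrix.vecMulLinear M⁻¹)
  refine ⟨‖L‖ + 1, by positivity, fun v => ?_⟩
  have h : L (Matrix.vecMul v M) = v := by
    simp [L, Matrix.vecMul_vecMul, Matrix.mul_nonsing_inv M hM]
  calc ‖v‖ = ‖L (Matrix.vecMul v M)‖ := by rw [h]
    _ ≤ ‖L‖ * ‖Matrix.vecMul v M‖ := L.le_opNorm _
    _ ≤ _ := by gcongr; linarith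

theorem rpow_mul_exp_eq {a b K r t γ θ : ℝ} (hK : 0 < K) (hr : 0 ≤ r) (ha : 0 ≤ a)
    (hθ : θ * (a + 1) = a - b) :
    (K * (r * Real.exp t)) ^ a * (r * Real.exp (-(b * t)) / γ) =
      K ^ a / γ * (r * Real.exp (θ * t)) ^ (a + 1) := by
  rw [Real.mul_rpow hK.le (by positivity), Real.mul_rpow hr (by positivity),
    Real.mul_rpow hr (by positivity), Real.rpow_add_of_nonneg hr ha zero_le_one, Real.rpow_one,
    ← Real.exp_mul, ← Real.exp_mul, show θ * t * (a + 1) = t * a + -(b * t) by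
      linear_combination t * hθ, Real.exp_add]
  ring

/-- (Dani–Kleinbock–Margulis lower bound.) If `M` is of the
parametrized form with `α` Diophantine of exponent `ε` and constant `C`, then
there is `C' > 0` with `δ(M E^t) > C' e^{-θ t}` for all `t ≥ 0`, where
`θ = (d-1)ε/(d + (d-1)ε)`. -/
theorem delta_lower_bound (m : ℕ) (hm : 1 ≤ m)
    (α β : Fin m → ℝ) (A : Matrix (Fin m) (Fin m) ℝ) (γ : ℝ) (hγ : 0 < γ)
    (ε C : ℝ) (hε : 0 < ε) (hC : 0 < C) (hdio : DioVec α ε C)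
    (M : Matrix (Fin (m+1)) (Fin (m+1)) ℝ)
    (hM : M = blockU α * blockL A β γ) (hdet : M.det = 1) :
    ∃ C' > (0:ℝ), ∀ t : ℝ, 0 ≤ t →
      C' * Real.exp (-(thetaOf m ε) * t) < deltaFn (M * Emat m t) := by
  obtain ⟨K, hK, hKM⟩ := exists_norm_le_mul_norm_vecMul M (by simp [hdet])
  have hm0 : (0 : ℝ) < m := by exact_mod_cast hm
  set a : ℝ := (m : ℝ) * (1 + ε) with ha
  have ha0 : 0 < a := by positivity
  have hθ0 : 0 ≤ thetaOf m ε := by unfold thetaOf; positivity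
  have hθ : thetaOf m ε * (a + 1) = a - m := by
    have : (m : ℝ) + 1 + m * ε ≠ 0 := by positivity
    rw [thetaOf, ha]
    field_simp
    ring
  set c : ℝ := min γ ((C * γ / K ^ a) ^ (a + 1)⁻¹)
  have hc0 : 0 < c := lt_min hγ (by positivity)
  refine ⟨c / 2, by positivity, fun t ht => ?_⟩
  have : Nonempty {k : Fin (m + 1) → ℤ // k ≠ 0} := ⟨1, one_ne_zero⟩
  suffices h : c * Real.exp (-(thetaOf m ε) * t) ≤ deltaFn (M * Emat m t) by
    have := mul_pos hc0 (Real.exp_pos (-(thetaOf m ε) * t))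
    linarith
  refine le_ciInf fun ⟨k, hk⟩ => ?_
  set v : Fin (m + 1) → ℝ := fun i => (k i : ℝ)
  set r := ‖Matrix.vecMul v (M * Emat m t)‖
  have hr : 0 ≤ r := norm_nonneg _
  rw [neg_mul, Real.exp_neg, ← div_eq_mul_inv, div_le_iff₀ (Real.exp_pos _)]
  have hs : |(∑ i : Fin m, (k i.castSucc : ℝ) * α i) + (k (Fin.last m) : ℝ)| ≤
      r * Real.exp (-(m * t)) / γ := by
    have h := abs_vecMul_last_le M t v
    rw [hM, vecMul_blockU_mul_blockL_last, ← hM, abs_mul, abs_of_pos hγ] at h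
    rwa [le_div_iff₀ hγ]
  by_cases hq : (fun i : Fin m => k i.castSucc) = 0
  · have hlast : k (Fin.last m) ≠ 0 := by
      contrapose! hk
      ext j
      induction j using Fin.lastCases with
      | last => exact hk
      | cast i => exact congrFun hq i
    have h1 : (1 : ℝ) ≤ |(k (Fin.last m) : ℝ)| := by
      exact_mod_cast Int.one_le_abs hlast
    have h0 : ∀ i : Fin m, k i.castSucc = 0 := congrFun hq
    simp only [h0, Int.cast_zero, zero_mul, Finset.sum_const_zero, zero_add] at hs
    have h2 := h1.trans hs
    rw [le_div_iff₀ hγ, one_mul] at h2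
    calc c ≤ γ := min_le_left _ _
      _ ≤ r * Real.exp (-(m * t)) := h2
      _ ≤ r * Real.exp (thetaOf m ε * t) := by
        gcongr
        nlinarith [mul_nonneg hm0.le ht, mul_nonneg hθ0 ht]
  · refine (min_le_right _ _).trans ?_
    rw [Real.rpow_inv_le_iff_of_pos (by positivity) (by positivity) (by positivity),
      div_le_iff₀ (by positivity), ← le_div_iff₀ hγ]
    have hqn : ‖(fun i => (k i.castSucc : ℝ) : Fin m → ℝ)‖ ≤ K * (r * Real.exp t) := by
      have hqv : ‖(fun i => (k i.castSucc : ℝ) : Fin m → ℝ)‖ ≤ ‖v‖ :=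
        (pi_norm_le_iff_of_nonneg (norm_nonneg v)).2 fun i => norm_le_pi_norm v i.castSucc
      refine hqv.trans ((hKM v).trans ?_)
      exact mul_le_mul_of_nonneg_left (norm_vecMul_le_norm_vecMul_mul_Emat M ht v) hK.le
    calc C ≤ _ := (hdio _ hq (k (Fin.last m))).le
      _ ≤ (K * (r * Real.exp t)) ^ a * (r * Real.exp (-(m * t)) / γ) := by gcongr
      _ = K ^ a / γ * (r * Real.exp (thetaOf m ε * t)) ^ (a + 1) :=
        rpow_mul_exp_eq hK hr ha0.le hθ
      _ = _ := by ring
end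

section
/- In the continued fraction setting (M of the parametrized form with α Diophantine of exponent ε, times t_0 = 0 < t_1 < t_2 < ⋯, P^{(n)} ∈ SL(d,ℤ) with M^{(n)} := P^{(n)} M E^{t_n} ∈ S_d(κ), δt_n := t_n − t_{n−1}, T^{(n)} := P^{(n)}(P^{(n−1)})^{−1}, θ = (d−1)ε/(d+(d−1)ε)), there are constants c₁,…,c₆ > 0 such that for all n ≥ 0: ‖M^{(n)}‖ ≤ c₁·exp[(d−1)θ t_n], ‖(M^{(n)})^{−1}‖ ≤ c₂·exp(θ t_n), ‖P^{(n)}‖ ≤ c₃·exp[(dθ + 1 − θ) t_n], ‖(P^{(n)})^{−1}‖ ≤ c₄·exp[(d−1+θ) t_n], and for all n ≥ 1: ‖T^{(n)}‖ ≤ c₅·exp[(1−θ)δt_n + dθ t_n], ‖(T^{(n)})^{−1}‖ ≤ c₆·exp[(d−1)(1−θ)δt_n + dθ t_n]. -/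
open scoped BigOperators
open Matrix

section NormEstimates

open scoped Matrix.Norms.L2Operator

theorem eucNorm_eq_norm_toLp {n : ℕ} (v : Fin n → ℝ) : eucNorm v = ‖WithLp.toLp 2 v‖ := by
  simp [eucNorm, EuclideanSpace.norm_eq]

theorem eucOpNorm_le_norm {n : ℕ} (X : Matrix (Fin n) (Fin n) ℝ) : eucOpNorm X ≤ ‖X‖ := by
  refine Real.sSup_le ?_ (norm_nonneg X)
  rintro _ ⟨v, hv, rfl⟩
  rw [eucNorm_eq_norm_toLp] at hv ⊢
  calc ‖WithLp.toLp 2 (X.mulVec v)‖ ≤ ‖X‖ * ‖WithLp.toLp 2 v‖ :=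
        Matrix.l2_opNorm_mulVec X (WithLp.toLp 2 v)
    _ ≤ ‖X‖ := mul_le_of_le_one_right (norm_nonneg X) hv

theorem norm_le_one_of_mul_transpose {n : ℕ} {K : Matrix (Fin n) (Fin n) ℝ}
    (hK : K * K.transpose = 1) : ‖K‖ ≤ 1 := by
  have h : ‖K * star K‖ = ‖K‖ * ‖K‖ := CStarRing.norm_self_mul_star
  have h1 : K * star K = 1 := by
    rw [Matrix.star_eq_conjTranspose, Matrix.conjTranspose_eq_transpose_of_trivial, hK]
  have h2 : ‖(1 : Matrix (Fin n) (Fin n) ℝ)‖ ≤ 1 := by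
    rw [← Matrix.diagonal_one, Matrix.l2_opNorm_diagonal]
    exact (pi_norm_le_iff_of_nonneg zero_le_one).2 fun i => by simp
  rw [h1] at h
  nlinarith [norm_nonneg K]

theorem abs_entry_le_one_of_mul_transpose {n : ℕ} {K : Matrix (Fin n) (Fin n) ℝ}
    (hK : K * K.transpose = 1) (i j : Fin n) : |K i j| ≤ 1 := by
  have h : ∑ l, K i l * K i l = 1 := by
    have := congrFun (congrFun hK i) i
    simpa [Matrix.mul_apply] using this
  have h2 : K i j * K i j ≤ ∑ l, K i l * K i l :=
    Finset.single_le_sum (f := fun l => K i l * K i l) (fun l _ => mul_self_nonneg _)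
      (Finset.mem_univ j)
  exact abs_le_one_iff_mul_self_le_one.2 (h2.trans h.le)

theorem exists_norm_and_adjugate_norm_le (n : ℕ) (b : ℝ) :
    ∃ B > 0, ∀ N : Matrix (Fin n) (Fin n) ℝ, (∀ i j, |N i j| ≤ b) →
      ‖N‖ ≤ B ∧ ‖N.adjugate‖ ≤ B := by
  have hc : IsCompact {N : Matrix (Fin n) (Fin n) ℝ | ∀ i j, N i j ∈ Set.Icc (-b) b} := by
    have h : {N : Fin n → Fin n → ℝ | ∀ i j, N i j ∈ Set.Icc (-b) b} =
        Set.univ.pi fun _ => Set.univ.pi fun _ => Set.Icc (-b) b := by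
      ext N
      simp only [Set.mem_ofPred_eq, Set.mem_pi, Set.mem_univ, true_imp_iff]
    have hpi : IsCompact {N : Fin n → Fin n → ℝ | ∀ i j, N i j ∈ Set.Icc (-b) b} := by
      rw [h]
      exact isCompact_univ_pi fun _ => isCompact_univ_pi fun _ => isCompact_Icc
    exact hpi
  obtain ⟨B₁, h₁⟩ := hc.exists_bound_of_continuousOn
    (f := fun N : Matrix (Fin n) (Fin n) ℝ => N) continuousOn_id
  obtain ⟨B₂, h₂⟩ := hc.exists_bound_of_continuousOn
    (f := fun N : Matrix (Fin n) (Fin n) ℝ => N.adjugate)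
    (Continuous.matrix_adjugate continuous_id).continuousOn
  refine ⟨max 1 (max B₁ B₂), by positivity, fun N hN => ?_⟩
  have hmem : N ∈ {N : Matrix (Fin n) (Fin n) ℝ | ∀ i j, N i j ∈ Set.Icc (-b) b} :=
    fun i j => abs_le.1 (hN i j)
  exact ⟨(h₁ N hmem).trans (by simp), (h₂ N hmem).trans (by simp)⟩

theorem norm_diagonal_le {n : ℕ} {a : Fin n → ℝ} {b : ℝ} (hb : 0 ≤ b) (h : ∀ i, |a i| ≤ b) :
    ‖Matrix.diagonal a‖ ≤ b := by
  rw [Matrix.l2_opNorm_diagonal]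
  exact (pi_norm_le_iff_of_nonneg hb).2 h

theorem Emat_mul_neg (m : ℕ) (t : ℝ) : Emat m t * Emat m (-t) = 1 := by
  rw [Emat, Emat, Matrix.diagonal_mul_diagonal, ← Matrix.diagonal_one]
  congr 1
  funext i
  refine Fin.lastCases ?_ (fun i => ?_) i <;> simp [← Real.exp_add]

theorem Emat_add (m : ℕ) (s t : ℝ) : Emat m (s + t) = Emat m s * Emat m t := by
  rw [Emat, Emat, Emat, Matrix.diagonal_mul_diagonal]
  congr 1
  funext i
  refine Fin.lastCases ?_ (fun i => ?_) i <;> simp [← Real.exp_add] <;> ring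

theorem norm_Emat_le {m : ℕ} {t : ℝ} (ht : 0 ≤ t) : ‖Emat m t‖ ≤ Real.exp (m * t) := by
  refine norm_diagonal_le (Real.exp_pos _).le fun i => ?_
  have : 0 ≤ (m : ℝ) * t := by positivity
  refine Fin.lastCases ?_ (fun i => ?_) i
  · simp
  · simp only [Fin.snoc_castSucc, Real.abs_exp, Real.exp_le_exp]
    linarith

theorem norm_Emat_neg_le {m : ℕ} {t : ℝ} (ht : 0 ≤ t) : ‖Emat m (-t)‖ ≤ Real.exp t := by
  refine norm_diagonal_le (Real.exp_pos _).le fun i => ?_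
  have : 0 ≤ (m : ℝ) * t := by positivity
  refine Fin.lastCases ?_ (fun i => ?_) i
  · simp only [Fin.snoc_last, Real.abs_exp, Real.exp_le_exp]
    linarith
  · simp

/-- In a Siegel set, a lower bound on the last row controls the matrix and its inverse. -/
theorem exists_siegel_norm_bound (m : ℕ) (κ : ℝ) :
    ∃ B > 0, ∀ X : Matrix (Fin (m+1)) (Fin (m+1)) ℝ, InSiegelSet κ X → ∀ r > 0,
      (∀ L, (∀ j, |X (Fin.last m) j| ≤ L) → r ≤ L) →
        ‖X‖ ≤ B * (r ^ m)⁻¹ ∧ ‖X⁻¹‖ ≤ B * r⁻¹ := by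
  obtain ⟨B, hB, hN⟩ := exists_norm_and_adjugate_norm_le (m+1) (max 1 κ)
  set s : ℝ := Real.sqrt 3 / 2
  have hs : 0 < s := by positivity
  have hs1 : s ≤ 1 := by
    have : Real.sqrt 3 ≤ 2 := Real.sqrt_le_iff.2 ⟨by norm_num, by norm_num⟩
    simp only [s]; linarith
  refine ⟨max (B * ((s ^ m) ^ m)⁻¹) (B * (s ^ m)⁻¹), by positivity, ?_⟩
  rintro X ⟨N, K, a, ⟨hN1, hN0, hNκ, ha, hprod, has, hK, -⟩, rfl⟩ r hr hrow
  have hNb : ∀ i j, |N i j| ≤ max 1 κ := fun i j => by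
    rcases lt_trichotomy i j with h | h | h
    · exact (hNκ i j h).trans (le_max_right _ _)
    · subst h; simp [hN1]
    · simp [hN0 i j h]
  have hlast : r ≤ a (Fin.last m) := hrow _ fun j => by
    have : (N * Matrix.diagonal a * K) (Fin.last m) j = a (Fin.last m) * K (Fin.last m) j := by
      rw [Matrix.mul_apply, Finset.sum_eq_single (Fin.last m)]
      · simp [Matrix.mul_diagonal, hN1]
      · intro l _ hl
        simp [Matrix.mul_diagonal, hN0 _ l (Fin.lt_last_iff_ne_last.2 hl)]
      · simp
    rw [this, abs_mul, abs_of_pos (ha _)]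
    exact mul_le_of_le_one_right (ha _).le (abs_entry_le_one_of_mul_transpose hK _ _)
  have hdesc : ∀ i : Fin (m+1), s ^ (m - i.val) * a (Fin.last m) ≤ a i := by
    intro i
    induction i using Fin.reverseInduction with
    | last => simp
    | cast i ih =>
      have : m - (i.castSucc : ℕ) = (m - (i.succ : ℕ)) + 1 := by
        simp only [Fin.val_castSucc, Fin.val_succ]; omega
      rw [this, pow_succ]
      calc _ = s * (s ^ (m - (i.succ : ℕ)) * a (Fin.last m)) := by ring
        _ ≤ s * a i.succ := by gcongr
        _ ≤ _ := has i
  have hlow : ∀ i, s ^ m * r ≤ a i := fun i => by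
    refine le_trans ?_ (hdesc i)
    exact mul_le_mul (pow_le_pow_of_le_one hs.le hs1 (Nat.sub_le _ _)) hlast hr.le (by positivity)
  have hup : ∀ i, a i ≤ ((s ^ m * r) ^ m)⁻¹ := fun i => by
    have h1 : (s ^ m * r) ^ m ≤ ∏ j ∈ Finset.univ.erase i, a j := by
      have := Finset.prod_le_prod (s := Finset.univ.erase i) (f := fun _ => s ^ m * r) (g := a)
        (fun _ _ => by positivity) (fun j _ => hlow j)
      simpa using this
    have h2 := Finset.mul_prod_erase Finset.univ a (Finset.mem_univ i)
    rw [hprod] at h2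
    rw [le_inv_comm₀ (ha i) (by positivity), inv_eq_one_div, le_div_iff₀ (ha i)]
    nlinarith [ha i]
  have hdetN : N.det = 1 := by
    rw [Matrix.det_of_isUpperTriangular (fun i j h => hN0 i j h)]
    simp [hN1]
  have hNinv : N * N.adjugate = 1 := by rw [Matrix.mul_adjugate, hdetN, one_smul]
  have hinv : (N * Matrix.diagonal a * K)⁻¹ =
      K.transpose * Matrix.diagonal (fun i => (a i)⁻¹) * N.adjugate := by
    refine Matrix.inv_eq_right_inv ?_
    have hd : Matrix.diagonal a * Matrix.diagonal (fun i => (a i)⁻¹) = 1 := by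
      rw [Matrix.diagonal_mul_diagonal, ← Matrix.diagonal_one]
      congr 1
      funext i
      exact mul_inv_cancel₀ (ha i).ne'
    calc _ = N * (Matrix.diagonal a * (K * K.transpose) *
          Matrix.diagonal (fun i => (a i)⁻¹)) * N.adjugate := by simp only [Matrix.mul_assoc]
      _ = 1 := by rw [hK, Matrix.mul_one, hd, Matrix.mul_one, hNinv]
  have hKt : ‖K.transpose‖ ≤ 1 := norm_le_one_of_mul_transpose (by
    rw [Matrix.transpose_transpose]; exact mul_eq_one_comm.1 hK)
  constructor
  · calc _ ≤ ‖N‖ * ‖Matrix.diagonal a‖ * ‖K‖ :=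
          (norm_mul_le _ _).trans (by gcongr; exact norm_mul_le _ _)
      _ ≤ B * ((s ^ m * r) ^ m)⁻¹ * 1 := by
          gcongr
          · exact (hN N hNb).1
          · exact norm_diagonal_le (by positivity) fun i => by
              rw [abs_of_pos (ha i)]; exact hup i
          · exact norm_le_one_of_mul_transpose hK
      _ = B * ((s ^ m) ^ m)⁻¹ * (r ^ m)⁻¹ := by rw [mul_pow, mul_inv]; ring
      _ ≤ _ := by gcongr; exact le_max_left _ _
  · rw [hinv]
    calc _ ≤ ‖K.transpose‖ * ‖Matrix.diagonal (fun i => (a i)⁻¹)‖ * ‖N.adjugate‖ :=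
          (norm_mul_le _ _).trans (by gcongr; exact norm_mul_le _ _)
      _ ≤ 1 * (s ^ m * r)⁻¹ * B := by
          gcongr
          · exact norm_diagonal_le (by positivity) fun i => by
              rw [abs_of_pos (inv_pos.2 (ha i))]
              exact inv_anti₀ (by positivity) (hlow i)
          · exact (hN N hNb).2
      _ = B * (s ^ m)⁻¹ * r⁻¹ := by rw [mul_inv]; ring
      _ ≤ _ := by gcongr; exact le_max_right _ _

theorem blockU_mul_blockL_last {m : ℕ} (α β : Fin m → ℝ) (A : Matrix (Fin m) (Fin m) ℝ) (γ : ℝ)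
    (v : Fin (m+1) → ℝ) :
    Matrix.vecMul v (blockU α * blockL A β γ) (Fin.last m) =
      γ * (∑ i : Fin m, v i.castSucc * α i + v (Fin.last m)) := by
  simp [Matrix.vecMul, dotProduct, Matrix.mul_apply, Fin.sum_univ_castSucc, blockU, blockL,
    mul_add, Finset.mul_sum, mul_comm, mul_left_comm]

/-- A Diophantine condition on `α` bounds the nonzero vectors of the lattice `ℤ^d M E^t`
away from zero. -/
theorem exists_lattice_lower_bound {m : ℕ} {α β : Fin m → ℝ} {A : Matrix (Fin m) (Fin m) ℝ}
    {γ : ℝ} (hγ : 0 < γ) {ε C : ℝ} (hε : 0 < ε) (hC : 0 < C) (hdio : DioVec α ε C)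
    {M : Matrix (Fin (m+1)) (Fin (m+1)) ℝ} (hM : M = blockU α * blockL A β γ)
    (hdet : M.det = 1) :
    ∃ c > 0, ∀ t, 0 ≤ t → ∀ k : Fin (m+1) → ℤ, k ≠ 0 → ∀ L,
      (∀ j, |Matrix.vecMul (fun i => (k i : ℝ)) (M * Emat m t) j| ≤ L) →
        c * Real.exp (-(thetaOf m ε * t)) ≤ L := by
  set B : ℝ := 1 + ∑ i, ∑ j, |M⁻¹ j i|
  have hB : 0 < B := by positivity
  have hθ : 0 ≤ thetaOf m ε := by unfold thetaOf; positivity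
  set c : ℝ := min B⁻¹ (min (γ * C) γ)
  have hc : 0 < c := by positivity
  refine ⟨c, hc, fun t ht k hk L hL => ?_⟩
  set v : Fin (m+1) → ℝ := Matrix.vecMul (fun i => (k i : ℝ)) M with hv
  have hmt : 0 ≤ (m : ℝ) * t := by positivity
  have hL0 : 0 ≤ L := (abs_nonneg _).trans (hL 0)
  have hfirst : ∀ i : Fin m, |v i.castSucc| ≤ Real.exp t * L := fun i => by
    have := hL i.castSucc
    rw [← Matrix.vecMul_vecMul, Emat, Matrix.vecMul_diagonal, Fin.snoc_castSucc, abs_mul,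
      Real.abs_exp, Real.exp_neg, ← div_eq_mul_inv, div_le_iff₀ (Real.exp_pos _)] at this
    linarith
  have hlast : |v (Fin.last m)| ≤ Real.exp (-(m * t)) * L := by
    have := hL (Fin.last m)
    rw [← Matrix.vecMul_vecMul, Emat, Matrix.vecMul_diagonal, Fin.snoc_last, abs_mul,
      Real.abs_exp, ← le_div_iff₀ (Real.exp_pos _), div_eq_mul_inv, ← Real.exp_neg] at this
    linarith
  have hall : ∀ j, |v j| ≤ Real.exp t * L := fun j => by
    refine Fin.lastCases ?_ hfirst j
    refine hlast.trans ?_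
    gcongr
    linarith
  have hkv : (fun i => (k i : ℝ)) = Matrix.vecMul v M⁻¹ := by
    rw [hv, Matrix.vecMul_vecMul, Matrix.mul_nonsing_inv _ (by rw [hdet]; exact isUnit_one),
      Matrix.vecMul_one]
  have hkB : ∀ i, |(k i : ℝ)| ≤ B * (Real.exp t * L) := fun i => by
    have h1 : (k i : ℝ) = ∑ j, v j * M⁻¹ j i := congrFun hkv i
    rw [h1]
    calc _ ≤ ∑ j, |v j * M⁻¹ j i| := Finset.abs_sum_le_sum_abs _ _
      _ ≤ ∑ j, Real.exp t * L * |M⁻¹ j i| := by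
          refine Finset.sum_le_sum fun j _ => ?_
          rw [abs_mul]
          gcongr
          exact hall j
      _ = (∑ j, |M⁻¹ j i|) * (Real.exp t * L) := by rw [← Finset.mul_sum]; ring
      _ ≤ _ := by
          gcongr
          have := Finset.single_le_sum (f := fun i => ∑ j, |M⁻¹ j i|)
            (fun i _ => Finset.sum_nonneg fun j _ => abs_nonneg _) (Finset.mem_univ i)
          linarith
  have hvlast : v (Fin.last m) =
      γ * (∑ i : Fin m, (k i.castSucc : ℝ) * α i + (k (Fin.last m) : ℝ)) := by
    rw [hv, hM, blockU_mul_blockL_last]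
  rw [hvlast, abs_mul, abs_of_pos hγ] at hlast
  by_cases hq : (fun i : Fin m => k i.castSucc) = 0
  · have hq' : ∀ i : Fin m, k i.castSucc = 0 := fun i => congrFun hq i
    have hkl : k (Fin.last m) ≠ 0 := fun h0 =>
      hk (funext fun j => Fin.lastCases h0 hq' j)
    have h1 : (1 : ℝ) ≤ |(k (Fin.last m) : ℝ)| := by
      exact_mod_cast Int.one_le_abs hkl
    simp only [hq', Int.cast_zero, zero_mul, Finset.sum_const_zero, zero_add] at hlast
    have h2 : Real.exp (-(m * t)) * L ≤ L :=
      mul_le_of_le_one_left hL0 (Real.exp_le_one_iff.2 (by linarith))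
    have h3 : Real.exp (-(thetaOf m ε * t)) ≤ 1 :=
      Real.exp_le_one_iff.2 (by have := mul_nonneg hθ ht; linarith)
    calc c * Real.exp (-(thetaOf m ε * t)) ≤ c := mul_le_of_le_one_right hc.le h3
      _ ≤ γ := (min_le_right _ _).trans (min_le_right _ _)
      _ ≤ L := by nlinarith
  · by_contra! hlt
    have hp : 0 ≤ (m : ℝ) * (1 + ε) := by positivity
    have hd := hdio _ hq (k (Fin.last m))
    have hnorm : ‖(fun i : Fin m => ((k i.castSucc : ℤ) : ℝ))‖ ≤
        Real.exp ((1 - thetaOf m ε) * t) := by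
      refine (pi_norm_le_iff_of_nonneg (Real.exp_pos _).le).2 fun i => ?_
      calc _ ≤ B * (Real.exp t * L) := hkB i.castSucc
        _ ≤ B * (Real.exp t * (c * Real.exp (-(thetaOf m ε * t)))) := by gcongr
        _ = (B * c) * Real.exp ((1 - thetaOf m ε) * t) := by
            rw [show (1 - thetaOf m ε) * t = t + -(thetaOf m ε * t) by ring, Real.exp_add]; ring
        _ ≤ 1 * Real.exp ((1 - thetaOf m ε) * t) := by
            gcongr
            calc B * c ≤ B * B⁻¹ := by gcongr; exact min_le_left _ _
              _ = 1 := mul_inv_cancel₀ hB.ne'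
        _ = _ := one_mul _
    have hs : |∑ i : Fin m, (k i.castSucc : ℝ) * α i + (k (Fin.last m) : ℝ)| ≤
        C * Real.exp (-(m * t) - thetaOf m ε * t) := by
      refine le_of_mul_le_mul_left (hlast.trans ?_) hγ
      calc _ ≤ Real.exp (-(m * t)) * (c * Real.exp (-(thetaOf m ε * t))) := by gcongr
        _ = c * Real.exp (-(m * t) - thetaOf m ε * t) := by
            rw [sub_eq_add_neg, Real.exp_add]; ring
        _ ≤ (γ * C) * Real.exp (-(m * t) - thetaOf m ε * t) := by
            gcongr
            exact (min_le_right _ _).trans (min_le_left _ _)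
        _ = _ := by ring
    have hexp : (1 - thetaOf m ε) * t * ((m : ℝ) * (1 + ε)) +
        (-(m * t) - thetaOf m ε * t) = 0 := by
      unfold thetaOf
      have : ((m + 1 : ℝ) + (m : ℝ) * ε) ≠ 0 := by positivity
      field_simp
      ring
    refine absurd hd (not_lt.2 ?_)
    calc _ ≤ Real.exp ((1 - thetaOf m ε) * t) ^ ((m : ℝ) * (1 + ε)) *
          (C * Real.exp (-(m * t) - thetaOf m ε * t)) := by gcongr
      _ = C * Real.exp ((1 - thetaOf m ε) * t * ((m : ℝ) * (1 + ε)) +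
          (-(m * t) - thetaOf m ε * t)) := by rw [← Real.exp_mul, Real.exp_add]; ring
      _ = C := by rw [hexp, Real.exp_zero, mul_one]

theorem row_ne_zero_of_det_eq_one {n : ℕ} {P : Matrix (Fin n) (Fin n) ℤ} (hP : P.det = 1)
    (i : Fin n) : P i ≠ 0 := fun h =>
  one_ne_zero (hP.symm.trans (Matrix.det_eq_zero_of_row_eq_zero i fun j => congrFun h j))

theorem norm_mul_mul_le {n : ℕ} {X Y Z : Matrix (Fin n) (Fin n) ℝ} {b x y z e : ℝ}
    (hx : ‖X‖ ≤ x) (hy : ‖Y‖ ≤ y) (hz : ‖Z‖ ≤ z) (h : x * y * z = b * Real.exp e) :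
    eucOpNorm (X * Y * Z) ≤ b * Real.exp e := by
  have hx0 := (norm_nonneg X).trans hx
  have hy0 := (norm_nonneg Y).trans hy
  rw [← h]
  calc _ ≤ ‖X * Y * Z‖ := eucOpNorm_le_norm _
    _ ≤ ‖X‖ * ‖Y‖ * ‖Z‖ := (norm_mul_le _ _).trans (by gcongr; exact norm_mul_le _ _)
    _ ≤ x * y * z := by gcongr

end NormEstimates

open scoped Matrix.Norms.L2Operator in

/-- (Norm estimates for the continued fraction algorithm.)
In the continued fraction setting — `M` of the parametrized form with `α`
Diophantine, `M^{(n)} = P^{(n)} M E^{t_n}` in a Siegel set,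
`T^{(n)} = P^{(n)}(P^{(n-1)})⁻¹`, `θ = (d-1)ε/(d+(d-1)ε)` — there are constants
`c₁,…,c₆ > 0` bounding `‖M^{(n)}‖`, `‖(M^{(n)})⁻¹‖`, `‖P^{(n)}‖`, `‖(P^{(n)})⁻¹‖`
(all `n ≥ 0`) and `‖T^{(n)}‖`, `‖(T^{(n)})⁻¹‖` (all `n ≥ 1`) as stated. -/
theorem cf_norm_estimates (m : ℕ) (hm : 1 ≤ m) (κ : ℝ) (hκ : 0 < κ)
    (α β : Fin m → ℝ) (A : Matrix (Fin m) (Fin m) ℝ) (γ : ℝ) (hγ : 0 < γ)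
    (ε C : ℝ) (hε : 0 < ε) (hC : 0 < C) (hdio : DioVec α ε C)
    (M : Matrix (Fin (m+1)) (Fin (m+1)) ℝ)
    (hM : M = blockU α * blockL A β γ) (hdet : M.det = 1)
    (t : ℕ → ℝ) (ht0 : t 0 = 0) (htmono : StrictMono t)
    (P : ℕ → Matrix (Fin (m+1)) (Fin (m+1)) ℤ) (hP : ∀ n, (P n).det = 1)
    (Mn : ℕ → Matrix (Fin (m+1)) (Fin (m+1)) ℝ)
    (hMn : ∀ n, Mn n = ((P n).map (Int.cast : ℤ → ℝ)) * M * Emat m (t n))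
    (hS : ∀ n, InSiegelSet κ (Mn n))
    (T : ℕ → Matrix (Fin (m+1)) (Fin (m+1)) ℝ)
    (hT : ∀ n, T n = ((P n).map (Int.cast : ℤ → ℝ)) *
      (((P (n-1)).map (Int.cast : ℤ → ℝ))⁻¹))
    (θ : ℝ) (hθ : θ = thetaOf m ε) :
    ∃ c₁ > (0:ℝ), ∃ c₂ > (0:ℝ), ∃ c₃ > (0:ℝ), ∃ c₄ > (0:ℝ), ∃ c₅ > (0:ℝ), ∃ c₆ > (0:ℝ),
      (∀ n : ℕ,
        eucOpNorm (Mn n) ≤ c₁ * Real.exp ((m : ℝ) * θ * t n) ∧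
        eucOpNorm ((Mn n)⁻¹) ≤ c₂ * Real.exp (θ * t n) ∧
        eucOpNorm ((P n).map (Int.cast : ℤ → ℝ)) ≤
          c₃ * Real.exp (((m + 1 : ℝ) * θ + 1 - θ) * t n) ∧
        eucOpNorm (((P n).map (Int.cast : ℤ → ℝ))⁻¹) ≤
          c₄ * Real.exp (((m : ℝ) + θ) * t n)) ∧
      (∀ n : ℕ, 1 ≤ n →
        eucOpNorm (T n) ≤
          c₅ * Real.exp ((1 - θ) * (t n - t (n - 1)) + (m + 1 : ℝ) * θ * t n) ∧
        eucOpNorm ((T n)⁻¹) ≤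
          c₆ * Real.exp ((m : ℝ) * (1 - θ) * (t n - t (n - 1)) +
            (m + 1 : ℝ) * θ * t n)) := by
  obtain ⟨c, hc, hlow⟩ := exists_lattice_lower_bound hγ hε hC hdio hM hdet
  obtain ⟨B, hB, hsiegel⟩ := exists_siegel_norm_bound m κ
  rw [← hθ] at hlow
  have ht : ∀ n, 0 ≤ t n := fun n => ht0 ▸ htmono.monotone (Nat.zero_le n)
  have hMnb : ∀ n, ‖Mn n‖ ≤ B * (c ^ m)⁻¹ * Real.exp (m * θ * t n) ∧
      ‖(Mn n)⁻¹‖ ≤ B * c⁻¹ * Real.exp (θ * t n) := fun n => by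
    have h := hsiegel (Mn n) (hS n) (c * Real.exp (-(θ * t n))) (by positivity)
      fun L hL => hlow (t n) (ht n) (P n (Fin.last m)) (row_ne_zero_of_det_eq_one (hP n) _) L
        fun j => by
          have := hL j
          rw [hMn, Matrix.mul_assoc] at this
          exact this
    rw [mul_pow, mul_inv, mul_inv, ← Real.exp_nat_mul, ← Real.exp_neg, ← Real.exp_neg] at h
    refine ⟨h.1.trans_eq ?_, h.2.trans_eq ?_⟩
    · rw [mul_assoc B]; ring_nf
    · rw [mul_assoc B, neg_neg]
  have hMu : M * M⁻¹ = 1 := Matrix.mul_nonsing_inv _ (by rw [hdet]; exact isUnit_one)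
  have hMu' : M⁻¹ * M = 1 := mul_eq_one_comm.1 hMu
  have hE : ∀ s, Emat m s * Emat m (-s) = 1 := Emat_mul_neg m
  have hMnu : ∀ n, Mn n * (Mn n)⁻¹ = 1 := fun n => by
    have hPd : ((P n).map (Int.cast : ℤ → ℝ)).det = 1 := by
      have := (Int.castRingHom ℝ).map_det (P n)
      rw [hP n, map_one] at this
      exact this.symm
    have hEd : IsUnit (Emat m (t n)).det :=
      (Matrix.isUnit_iff_isUnit_det _).1 (IsUnit.of_mul_eq_one _ (hE _))
    refine Matrix.mul_nonsing_inv _ ?_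
    rw [hMn, Matrix.det_mul, Matrix.det_mul, hPd, hdet, one_mul, one_mul]
    exact hEd
  have hPeq : ∀ n, (P n).map (Int.cast : ℤ → ℝ) = Mn n * Emat m (-t n) * M⁻¹ := fun n => by
    rw [hMn, Matrix.mul_assoc _ (Emat m (t n)), hE, Matrix.mul_one, Matrix.mul_assoc, hMu,
      Matrix.mul_one]
  have hPinv : ∀ n, ((P n).map (Int.cast : ℤ → ℝ))⁻¹ = M * Emat m (t n) * (Mn n)⁻¹ := fun n => by
    refine Matrix.inv_eq_right_inv ?_
    rw [← Matrix.mul_assoc, ← Matrix.mul_assoc, ← hMn, hMnu]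
  have hEneg : ∀ r s, Emat m (-r) * Emat m s = Emat m (-(r - s)) := fun r s => by
    rw [← Emat_add]; congr 1; ring
  have hTeq : ∀ n, T n = Mn n * Emat m (-(t n - t (n-1))) * (Mn (n-1))⁻¹ := fun n => by
    rw [hT, hPinv, hPeq, ← hEneg]
    calc _ = Mn n * Emat m (-t n) * (M⁻¹ * M) * Emat m (t (n-1)) * (Mn (n-1))⁻¹ := by
          simp only [Matrix.mul_assoc]
      _ = _ := by rw [hMu', Matrix.mul_one]; simp only [Matrix.mul_assoc]
  have hTinv : ∀ n, (T n)⁻¹ = Mn (n-1) * Emat m (t n - t (n-1)) * (Mn n)⁻¹ := fun n => by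
    refine Matrix.inv_eq_right_inv ?_
    have hE' : Emat m (-(t n - t (n-1))) * Emat m (t n - t (n-1)) = 1 := mul_eq_one_comm.1 (hE _)
    calc _ = Mn n * Emat m (-(t n - t (n-1))) * ((Mn (n-1))⁻¹ * Mn (n-1)) *
          Emat m (t n - t (n-1)) * (Mn n)⁻¹ := by rw [hTeq]; simp only [Matrix.mul_assoc]
      _ = 1 := by
          rw [mul_eq_one_comm.1 (hMnu (n-1)), Matrix.mul_one, Matrix.mul_assoc (Mn n), hE',
            Matrix.mul_one, hMnu]
  have hM0 : 0 < ‖M‖ := norm_pos_iff.2 fun h => by simp [h] at hMu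
  have hMi0 : 0 < ‖M⁻¹‖ := norm_pos_iff.2 fun h => by simp [h] at hMu
  refine ⟨B * (c ^ m)⁻¹, by positivity, B * c⁻¹, by positivity, B * (c ^ m)⁻¹ * ‖M⁻¹‖,
    by positivity, ‖M‖ * (B * c⁻¹), by positivity, B * (c ^ m)⁻¹ * (B * c⁻¹), by positivity,
    B * (c ^ m)⁻¹ * (B * c⁻¹), by positivity, fun n => ⟨?_, ?_, ?_, ?_⟩, fun n hn => ?_⟩
  · exact (eucOpNorm_le_norm _).trans (hMnb n).1
  · exact (eucOpNorm_le_norm _).trans (hMnb n).2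
  · rw [hPeq]
    refine norm_mul_mul_le (hMnb n).1 (norm_Emat_neg_le (ht n)) le_rfl ?_
    rw [show ((m + 1 : ℝ) * θ + 1 - θ) * t n = m * θ * t n + t n by ring, Real.exp_add]
    ring
  · rw [hPinv]
    refine norm_mul_mul_le le_rfl (norm_Emat_le (ht n)) (hMnb n).2 ?_
    rw [add_mul, Real.exp_add]
    ring
  have hδ : 0 ≤ t n - t (n-1) := sub_nonneg.2 (htmono.monotone (Nat.sub_le n 1))
  constructor
  · rw [hTeq]
    refine norm_mul_mul_le (hMnb n).1 (norm_Emat_neg_le hδ) (hMnb (n-1)).2 ?_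
    rw [show (1 - θ) * (t n - t (n - 1)) + (m + 1 : ℝ) * θ * t n =
      m * θ * t n + (t n - t (n-1)) + θ * t (n-1) by ring, Real.exp_add, Real.exp_add]
    ring
  · rw [hTinv]
    refine norm_mul_mul_le (hMnb (n-1)).1 (norm_Emat_le hδ) (hMnb n).2 ?_
    rw [show (m : ℝ) * (1 - θ) * (t n - t (n - 1)) + (m + 1 : ℝ) * θ * t n =
      m * θ * t (n-1) + m * (t n - t (n-1)) + θ * t n by ring, Real.exp_add, Real.exp_add]
    ring
end
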